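/- arXiv:1706.07100 — 4 statements merged into one kernel-verified Lean document; each statement's English description precedes it below -/
import Mathlib

section
/- Let L > 0 and let q : [0,L] → ℂ be continuous. Then there exists a twice continuously differentiable function f : [0,L] → ℂ such that f''(x) = q(x) f(x) for all x ∈ [0,L], f(0) = 1, and f(x) ≠ 0 for every x ∈ [0,L]. -/
open Set Metric MeasureTheory in
/-- Global existence for linear fields bounded by `C`. -/
theorem linear_ode_global {E : Type*} [NormedAddCommGroup E] [NormedSpace ℝ E] [CompleteSpace E]
    (L C : ℝ) (hL : 0 < L) (hC : 0 ≤ C) (A : ℝ → E →ₗ[ℝ] E)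
    (hA : ∀ t ∈ Icc (0 : ℝ) L, ∀ x, ‖A t x‖ ≤ C * ‖x‖)
    (hcont : ∀ x, ContinuousOn (fun t => A t x) (Icc 0 L)) (x₀ : E) :
    ∃ α : ℝ → E, α 0 = x₀ ∧
      ∀ t ∈ Icc (0 : ℝ) L, HasDerivWithinAt α (A t (α t)) (Icc 0 L) t := by
  obtain ⟨R, hRdef⟩ : ∃ R, R = ‖x₀‖ * Real.exp (C * L) + 1 := ⟨_, rfl⟩
  have hR : 0 < R := by rw [hRdef]; positivity
  let P : E → E := fun x => (R / max R ‖x‖) • x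
  have hM : ∀ x : E, 0 < max R ‖x‖ := fun x => lt_max_of_lt_left hR
  have hP1 : ∀ x, ‖P x‖ ≤ ‖x‖ := by
    intro x
    simp only [P, norm_smul, Real.norm_eq_abs]
    rw [abs_of_nonneg (div_nonneg hR.le (hM x).le)]
    have : R / max R ‖x‖ ≤ 1 := (div_le_one (hM x)).2 (le_max_left _ _)
    exact mul_le_of_le_one_left (norm_nonneg _) this
  have hP2 : ∀ x, ‖P x‖ ≤ R := by
    intro x
    simp only [P, norm_smul, Real.norm_eq_abs]
    rw [abs_of_nonneg (div_nonneg hR.le (hM x).le), div_mul_eq_mul_div, div_le_iff₀ (hM x)]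
    exact mul_le_mul_of_nonneg_left (le_max_right _ _) hR.le
  have hP3 : ∀ x, ‖x‖ ≤ R → P x = x := by
    intro x hx
    simp only [P]
    rw [max_eq_left hx, div_self hR.ne', one_smul]
  have hP4 : ∀ x y, ‖P x - P y‖ ≤ 2 * ‖x - y‖ := by
    intro x y
    have e : P x - P y = (R / max R ‖x‖) • (x - y)
        + (R / max R ‖x‖ - R / max R ‖y‖) • y := by
      simp only [P, smul_sub, sub_smul]; abel
    rw [e]
    refine (norm_add_le _ _).trans ?_
    rw [norm_smul, norm_smul, Real.norm_eq_abs, Real.norm_eq_abs,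
      abs_of_nonneg (div_nonneg hR.le (hM x).le)]
    have h1 : R / max R ‖x‖ ≤ 1 := (div_le_one (hM x)).2 (le_max_left _ _)
    have h2 : R / max R ‖x‖ - R / max R ‖y‖
        = (R / max R ‖x‖) * ((max R ‖y‖ - max R ‖x‖) / max R ‖y‖) := by
      have := (hM x).ne'
      have := (hM y).ne'
      field_simp
    have h3 : |max R ‖y‖ - max R ‖x‖| ≤ ‖x - y‖ := by
      refine (abs_max_sub_max_le_max R ‖y‖ R ‖x‖).trans ?_
      rw [sub_self, abs_zero, max_eq_right (abs_nonneg _), norm_sub_rev]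
      exact abs_norm_sub_norm_le _ _
    have h4 : |R / max R ‖x‖ - R / max R ‖y‖| * ‖y‖ ≤ ‖x - y‖ := by
      rw [h2, abs_mul, abs_of_nonneg (div_nonneg hR.le (hM x).le), abs_div, abs_of_pos (hM y)]
      have h5 : |max R ‖y‖ - max R ‖x‖| / max R ‖y‖ * ‖y‖ ≤ ‖x - y‖ := by
        rw [div_mul_eq_mul_div, div_le_iff₀ (hM y)]
        exact mul_le_mul h3 (le_max_right _ _) (norm_nonneg _) (norm_nonneg _)
      rw [mul_assoc]
      refine (mul_le_of_le_one_left ?_ h1).trans h5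
      have := (hM y).le
      positivity
    have h6 := mul_le_of_le_one_left (norm_nonneg (x - y)) h1
    linarith
  have hPL : IsPicardLindelof (fun t x => A t (P x)) (tmin := 0) (tmax := L)
      ⟨0, left_mem_Icc.2 hL.le⟩ x₀ (Real.toNNReal (C * R * L)) 0 (Real.toNNReal (C * R))
      (Real.toNNReal (C * 2)) := by
    refine ⟨?_, ?_, ?_, ?_⟩
    · intro t ht
      refine LipschitzOnWith.of_dist_le_mul fun x _ y _ => ?_
      rw [dist_eq_norm, dist_eq_norm, ← map_sub, Real.coe_toNNReal _ (by positivity), mul_assoc]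
      exact (hA t ht _).trans (mul_le_mul_of_nonneg_left (hP4 x y) hC)
    · intro x _
      exact hcont (P x)
    · intro t ht x _
      rw [Real.coe_toNNReal _ (by positivity)]
      exact (hA t ht _).trans (mul_le_mul_of_nonneg_left (hP2 x) hC)
    · rw [Real.coe_toNNReal _ (by positivity), Real.coe_toNNReal _ (by positivity)]
      simp [hL.le]
  obtain ⟨α, h0, hα⟩ := hPL.exists_eq_forall_mem_Icc_hasDerivWithinAt₀
  have h0' : α 0 = x₀ := h0
  refine ⟨α, h0', fun t ht => ?_⟩
  have hb := norm_le_gronwallBound_of_norm_deriv_right_le (f := α) (f' := fun t => A t (P (α t)))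
    (δ := ‖x₀‖) (K := C) (ε := 0) (a := 0) (b := L)
    (fun t ht => (hα t ht).continuousWithinAt)
    (fun t ht => (hα t ⟨ht.1, ht.2.le⟩).mono_of_mem_nhdsWithin (Icc_mem_nhdsGE_of_mem ht))
    (by rw [h0'])
    (fun t ht => by
      rw [add_zero]
      exact (hA t ⟨ht.1, ht.2.le⟩ _).trans (mul_le_mul_of_nonneg_left (hP1 _) hC)) t ht
  rw [gronwallBound_ε0, sub_zero] at hb
  have hle : ‖α t‖ ≤ R := by
    have : Real.exp (C * t) ≤ Real.exp (C * L) :=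
      Real.exp_le_exp.2 (mul_le_mul_of_nonneg_left ht.2 hC)
    have := mul_le_mul_of_nonneg_left this (norm_nonneg x₀)
    linarith
  have := hα t ht
  simp only [hP3 _ hle] at this
  exact this

open Set in
theorem second_order_exists (L : ℝ) (hL : 0 < L) (q : ℝ → ℂ)
    (hq : ContinuousOn q (Icc 0 L)) (a b : ℂ) :
    ∃ f f' : ℝ → ℂ,
      (∀ x ∈ Icc (0 : ℝ) L, HasDerivWithinAt f (f' x) (Icc 0 L) x) ∧
      (∀ x ∈ Icc (0 : ℝ) L, HasDerivWithinAt f' (q x * f x) (Icc 0 L) x) ∧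
      f 0 = a ∧ f' 0 = b := by
  obtain ⟨B, hB⟩ := isCompact_Icc.exists_bound_of_continuousOn hq
  let A : ℝ → (ℂ × ℂ) →ₗ[ℝ] (ℂ × ℂ) := fun t =>
    { toFun := fun x => (x.2, q t * x.1)
      map_add' := fun x y => by ext <;> simp [mul_add]
      map_smul' := fun c x => by ext <;> simp <;> ring }
  have hAdef : ∀ t x, A t x = (x.2, q t * x.1) := fun _ _ => rfl
  obtain ⟨α, h0, hα⟩ := linear_ode_global L (max 1 B) hL (by positivity) A
    (fun t ht x => by
      rw [hAdef, Prod.norm_mk]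
      refine max_le ?_ ?_
      · calc ‖x.2‖ ≤ 1 * ‖x‖ := by rw [one_mul]; exact norm_snd_le x
          _ ≤ _ := mul_le_mul_of_nonneg_right (le_max_left _ _) (norm_nonneg _)
      · rw [norm_mul]
        exact mul_le_mul ((hB t ht).trans (le_max_right _ _)) (norm_fst_le x)
          (norm_nonneg _) (by positivity))
    (fun x => by
      simp only [hAdef]
      exact continuousOn_const.prodMk (hq.mul continuousOn_const)) (a, b)
  refine ⟨fun t => (α t).1, fun t => (α t).2, fun t ht => ?_, fun t ht => ?_, ?_, ?_⟩
  · exact (hα t ht).fst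
  · exact (hα t ht).snd
  · simp [h0]
  · simp [h0]

open Set MeasureTheory in
theorem exists_notMem_image (g : ℝ → ℂ) (s : Set ℝ) (hg : DifferentiableOn ℝ g s) :
    ∃ c : ℂ, c ∉ g '' s := by
  let T : Set ℂ := {z | z.im = 0 ∧ z.re ∈ s}
  have hT : volume T = 0 := by
    have h := Measure.addHaar_submodule (volume : Measure ℂ) (LinearMap.ker Complex.imLm) (by
      intro h
      have : Complex.I ∈ LinearMap.ker Complex.imLm := by rw [h]; trivial
      simp at this)
    refine measure_mono_null (fun z hz => ?_) h
    simpa using hz.1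
  have hd : DifferentiableOn ℝ (fun z : ℂ => g z.re) T :=
    hg.comp (Complex.reCLM.differentiable.differentiableOn) (fun z hz => hz.2)
  have h := addHaar_image_eq_zero_of_differentiableOn_of_addHaar_eq_zero (volume : Measure ℂ) hd hT
  by_contra! hc
  have : (fun z : ℂ => g z.re) '' T = univ := by
    refine eq_univ_of_forall fun c => ?_
    obtain ⟨x, hx, rfl⟩ := hc c
    exact ⟨(x : ℂ), ⟨by simp, by simpa using hx⟩, by simp⟩
  rw [this] at h
  exact (Measure.measure_univ_ne_zero.2 (NeZero.ne _)) h

/-- For `L > 0` and continuous `q : [0,L] → ℂ` there exists a twice continuously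
differentiable function `f : [0,L] → ℂ` (given here together with its first
derivative `f'`; the second derivative `q · f` is automatically continuous)
such that `f'' = q f` on `[0,L]`, `f(0) = 1` and `f` vanishes nowhere on `[0,L]`. -/
theorem exists_nonvanishing_solution (L : ℝ) (hL : 0 < L) (q : ℝ → ℂ)
    (hq : ContinuousOn q (Set.Icc 0 L)) :
    ∃ f f' : ℝ → ℂ,
      (∀ x ∈ Set.Icc (0 : ℝ) L, HasDerivWithinAt f (f' x) (Set.Icc 0 L) x) ∧
      (∀ x ∈ Set.Icc (0 : ℝ) L, HasDerivWithinAt f' (q x * f x) (Set.Icc 0 L) x) ∧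
      ContinuousOn f' (Set.Icc 0 L) ∧
      f 0 = 1 ∧
      (∀ x ∈ Set.Icc (0 : ℝ) L, f x ≠ 0) := by
  obtain ⟨u, u', hu, hu', u0, u'0⟩ := second_order_exists L hL q hq 1 0
  obtain ⟨v, v', hv, hv', v0, v'0⟩ := second_order_exists L hL q hq 0 1
  have hW : ∀ x ∈ Set.Icc (0 : ℝ) L, u x * v' x - u' x * v x = 1 := by
    have hd : ∀ x ∈ Set.Icc (0 : ℝ) L,
        HasDerivWithinAt (fun x => u x * v' x - u' x * v x) 0 (Set.Icc 0 L) x := by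
      intro x hx
      have := ((hu x hx).mul (hv' x hx)).sub ((hu' x hx).mul (hv x hx))
      refine this.congr_deriv ?_
      ring
    intro x hx
    have := constant_of_has_deriv_right_zero (fun x hx => (hd x hx).continuousWithinAt)
      (fun x hx => (hd x ⟨hx.1, hx.2.le⟩).mono_of_mem_nhdsWithin (Icc_mem_nhdsGE_of_mem hx)) x hx
    rw [this]
    simp [u0, u'0, v0, v'0]
  obtain ⟨c, hc⟩ := exists_notMem_image (fun x => -u x / v x)
    {x | x ∈ Set.Icc (0 : ℝ) L ∧ v x ≠ 0} (by
      intro x hx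
      have h1 := (hu x hx.1).differentiableWithinAt.mono
        (t := Set.Icc 0 L) (s := {x | x ∈ Set.Icc (0 : ℝ) L ∧ v x ≠ 0}) (fun y hy => hy.1)
      have h2 := (hv x hx.1).differentiableWithinAt.mono
        (t := Set.Icc 0 L) (s := {x | x ∈ Set.Icc (0 : ℝ) L ∧ v x ≠ 0}) (fun y hy => hy.1)
      exact h1.neg.div h2 hx.2)
  refine ⟨fun x => u x + c * v x, fun x => u' x + c * v' x, fun x hx => ?_, fun x hx => ?_,
    fun x hx => ?_, ?_, fun x hx h => ?_⟩
  · exact (hu x hx).add ((hv x hx).const_mul c)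
  · refine ((hu' x hx).add ((hv' x hx).const_mul c)).congr_deriv ?_
    ring
  · exact ((hu' x hx).add ((hv' x hx).const_mul c)).continuousWithinAt
  · simp [u0, v0]
  · by_cases hvx : v x = 0
    · have h' : u x = 0 := by simpa [hvx] using h
      have := hW x hx
      simp [hvx, h'] at this
    · refine hc ⟨x, ⟨hx, hvx⟩, ?_⟩
      have h' : u x + c * v x = 0 := h
      rw [div_eq_iff hvx]
      linear_combination -h'
end

section
/- Let L > 0, let q : [0,L] → ℂ be continuous, and let f : [0,L] → ℂ be a twice continuously differentiable nonvanishing solution of f'' = q f with f(0) = 1. Then each formal power φ_n is twice continuously differentiable on [0,L]; moreover φ_0'' = q φ_0 and φ_1'' = q φ_1 on [0,L], and for every n ≥ 2 one has φ_n''(x) − q(x) φ_n(x) = n(n−1) φ_{n−2}(x) for all x ∈ [0,L]. -/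
/-- The recursive integrals `X^{(n)}` : `X^{(0)} ≡ 1`,
`X^{(n)}(x) = n ∫_0^x X^{(n-1)}(s) (f²(s))^{(-1)^n} ds`. -/
noncomputable def Xodd (f : ℝ → ℂ) : ℕ → ℝ → ℂ
  | 0, _ => 1
  | n + 1, x =>
      (n + 1 : ℂ) * ∫ s in (0 : ℝ)..x, Xodd f n s * (f s ^ 2) ^ ((-1 : ℤ) ^ (n + 1))

/-- The recursive integrals `X̃^{(n)}` : `X̃^{(0)} ≡ 1`,
`X̃^{(n)}(x) = n ∫_0^x X̃^{(n-1)}(s) (f²(s))^{(-1)^{n-1}} ds`. -/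
noncomputable def Xeven (f : ℝ → ℂ) : ℕ → ℝ → ℂ
  | 0, _ => 1
  | n + 1, x =>
      (n + 1 : ℂ) * ∫ s in (0 : ℝ)..x, Xeven f n s * (f s ^ 2) ^ ((-1 : ℤ) ^ n)

/-- The formal powers associated with `f`: `φ_n = f X^{(n)}` for odd `n` and
`φ_n = f X̃^{(n)}` for even `n`. -/
noncomputable def formalPower (f : ℝ → ℂ) (n : ℕ) (x : ℝ) : ℂ :=
  if Odd n then f x * Xodd f n x else f x * Xeven f n x

open Set in
theorem aux_ftc {L : ℝ} {g : ℝ → ℂ} (hg : ContinuousOn g (Icc 0 L)) :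
    ∀ x ∈ Icc (0:ℝ) L, HasDerivWithinAt (fun y => ∫ s in (0:ℝ)..y, g s) (g x) (Icc 0 L) x := by
  intro x hx
  have : Fact (x ∈ Icc (0:ℝ) L) := ⟨hx⟩
  refine intervalIntegral.integral_hasDerivWithinAt_right (t := Icc 0 L) ?_ ?_ (hg x hx)
  · apply ContinuousOn.intervalIntegrable
    rw [uIcc_of_le hx.1]
    exact hg.mono (Icc_subset_Icc_right hx.2)
  · exact hg.stronglyMeasurableAtFilter_nhdsWithin measurableSet_Icc x

open Set in
theorem aux_cd {L : ℝ} (hL : 0 < L) {g g' g'' : ℝ → ℂ}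
    (h1 : ∀ x ∈ Icc (0 : ℝ) L, HasDerivWithinAt g (g' x) (Icc 0 L) x)
    (h2 : ∀ x ∈ Icc (0 : ℝ) L, HasDerivWithinAt g' (g'' x) (Icc 0 L) x)
    (h3 : ContinuousOn g'' (Icc 0 L)) :
    ContDiffOn ℝ 2 g (Icc 0 L) ∧
      ∀ x ∈ Icc (0 : ℝ) L, iteratedDerivWithin 2 g (Icc 0 L) x = g'' x := by
  have hu : UniqueDiffOn ℝ (Icc (0:ℝ) L) := uniqueDiffOn_Icc hL
  have e1 : ∀ x ∈ Icc (0:ℝ) L, derivWithin g (Icc 0 L) x = g' x :=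
    fun x hx => (h1 x hx).derivWithin (hu x hx)
  have e2 : ∀ x ∈ Icc (0:ℝ) L, derivWithin g' (Icc 0 L) x = g'' x :=
    fun x hx => (h2 x hx).derivWithin (hu x hx)
  have c1 : ContDiffOn ℝ 1 g' (Icc 0 L) := by
    rw [show (1 : WithTop ℕ∞) = 0 + 1 by simp, contDiffOn_succ_iff_derivWithin hu]
    refine ⟨fun x hx => (h2 x hx).differentiableWithinAt, by simp, ?_⟩
    rw [contDiffOn_zero]
    exact h3.congr e2
  constructor
  · rw [show (2 : WithTop ℕ∞) = 1 + 1 by norm_num, contDiffOn_succ_iff_derivWithin hu]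
    exact ⟨fun x hx => (h1 x hx).differentiableWithinAt, by simp, c1.congr e1⟩
  · intro x hx
    rw [iteratedDerivWithin_succ]
    rw [derivWithin_congr (f := g') (fun y hy => ?_) ?_, e2 x hx]
    · rw [iteratedDerivWithin_one, e1 x hx]
    · rw [iteratedDerivWithin_one, e1 _ (by assumption)]

open Set in
theorem aux_core {L : ℝ} (hL : 0 < L) {q f f' X Y W : ℝ → ℂ} {c : ℂ}
    (hq : ContinuousOn q (Icc 0 L))
    (hf : ∀ x ∈ Icc (0 : ℝ) L, HasDerivWithinAt f (f' x) (Icc 0 L) x)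
    (hf' : ∀ x ∈ Icc (0 : ℝ) L, HasDerivWithinAt f' (q x * f x) (Icc 0 L) x)
    (hfne : ∀ x ∈ Icc (0 : ℝ) L, f x ≠ 0)
    (hX : ∀ x ∈ Icc (0 : ℝ) L, HasDerivWithinAt X (c * (Y x * (f x ^ 2)⁻¹)) (Icc 0 L) x)
    (hY : ∀ x ∈ Icc (0 : ℝ) L, HasDerivWithinAt Y (W x * f x ^ 2) (Icc 0 L) x)
    (hW : ContinuousOn W (Icc 0 L)) :
    ContDiffOn ℝ 2 (fun x => f x * X x) (Icc 0 L) ∧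
      ∀ x ∈ Icc (0 : ℝ) L, iteratedDerivWithin 2 (fun x => f x * X x) (Icc 0 L) x
        = q x * (f x * X x) + c * W x * f x := by
  have cf : ContinuousOn f (Icc 0 L) := fun x hx => (hf x hx).continuousWithinAt
  have cX : ContinuousOn X (Icc 0 L) := fun x hx => (hX x hx).continuousWithinAt
  apply aux_cd hL (g' := fun x => f' x * X x + c * (Y x * (f x)⁻¹))
  · intro x hx
    have hne := hfne x hx
    refine ((hf x hx).mul (hX x hx)).congr_deriv ?_
    field_simp
  · intro x hx
    have hne := hfne x hx
    refine (((hf' x hx).mul (hX x hx)).add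
      (((hY x hx).mul ((hf x hx).fun_inv hne)).const_mul c)).congr_deriv ?_
    field_simp
    ring
  · fun_prop

open Set in
theorem aux_Xodd {L : ℝ} {f : ℝ → ℂ} (cf : ContinuousOn f (Icc 0 L))
    (hfne : ∀ x ∈ Icc (0 : ℝ) L, f x ≠ 0) (n : ℕ) :
    ContinuousOn (Xodd f n) (Icc 0 L) ∧ ∀ x ∈ Icc (0 : ℝ) L, HasDerivWithinAt (Xodd f (n+1))
      ((n + 1 : ℂ) * (Xodd f n x * (f x ^ 2) ^ ((-1 : ℤ) ^ (n + 1)))) (Icc 0 L) x := by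
  have key : ∀ n, ContinuousOn (Xodd f n) (Icc 0 L) →
      ∀ x ∈ Icc (0 : ℝ) L, HasDerivWithinAt (Xodd f (n+1))
      ((n + 1 : ℂ) * (Xodd f n x * (f x ^ 2) ^ ((-1 : ℤ) ^ (n + 1)))) (Icc 0 L) x := by
    intro n hn x hx
    have hc : ContinuousOn (fun s => Xodd f n s * (f s ^ 2) ^ ((-1 : ℤ) ^ (n + 1))) (Icc 0 L) :=
      hn.mul ((cf.pow 2).zpow₀ _ fun x hx => Or.inl (pow_ne_zero 2 (hfne x hx)))
    exact (aux_ftc hc x hx).const_mul _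
  have c : ContinuousOn (Xodd f n) (Icc 0 L) := by
    induction n with
    | zero => exact continuousOn_const (c := (1:ℂ))
    | succ n ih => exact fun x hx => (key n ih x hx).continuousWithinAt
  exact ⟨c, key n c⟩

open Set in
theorem aux_Xeven {L : ℝ} {f : ℝ → ℂ} (cf : ContinuousOn f (Icc 0 L))
    (hfne : ∀ x ∈ Icc (0 : ℝ) L, f x ≠ 0) (n : ℕ) :
    ContinuousOn (Xeven f n) (Icc 0 L) ∧ ∀ x ∈ Icc (0 : ℝ) L, HasDerivWithinAt (Xeven f (n+1))
      ((n + 1 : ℂ) * (Xeven f n x * (f x ^ 2) ^ ((-1 : ℤ) ^ n))) (Icc 0 L) x := by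
  have key : ∀ n, ContinuousOn (Xeven f n) (Icc 0 L) →
      ∀ x ∈ Icc (0 : ℝ) L, HasDerivWithinAt (Xeven f (n+1))
      ((n + 1 : ℂ) * (Xeven f n x * (f x ^ 2) ^ ((-1 : ℤ) ^ n))) (Icc 0 L) x := by
    intro n hn x hx
    have hc : ContinuousOn (fun s => Xeven f n s * (f s ^ 2) ^ ((-1 : ℤ) ^ n)) (Icc 0 L) :=
      hn.mul ((cf.pow 2).zpow₀ _ fun x hx => Or.inl (pow_ne_zero 2 (hfne x hx)))
    exact (aux_ftc hc x hx).const_mul _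
  have c : ContinuousOn (Xeven f n) (Icc 0 L) := by
    induction n with
    | zero => exact continuousOn_const (c := (1:ℂ))
    | succ n ih => exact fun x hx => (key n ih x hx).continuousWithinAt
  exact ⟨c, key n c⟩

/-- Each formal power `φ_n` is twice continuously differentiable on `[0,L]`;
`φ_0'' = q φ_0`, `φ_1'' = q φ_1`, and for `n ≥ 2`,
`φ_n'' - q φ_n = n(n-1) φ_{n-2}` on `[0,L]`. -/
theorem formalPower_second_derivative (L : ℝ) (hL : 0 < L) (q f f' : ℝ → ℂ)
    (hq : ContinuousOn q (Set.Icc 0 L))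
    (hf : ∀ x ∈ Set.Icc (0 : ℝ) L, HasDerivWithinAt f (f' x) (Set.Icc 0 L) x)
    (hf' : ∀ x ∈ Set.Icc (0 : ℝ) L, HasDerivWithinAt f' (q x * f x) (Set.Icc 0 L) x)
    (hf0 : f 0 = 1)
    (hfne : ∀ x ∈ Set.Icc (0 : ℝ) L, f x ≠ 0) :
    (∀ n : ℕ, ContDiffOn ℝ 2 (formalPower f n) (Set.Icc 0 L)) ∧
    (∀ x ∈ Set.Icc (0 : ℝ) L,
      iteratedDerivWithin 2 (formalPower f 0) (Set.Icc 0 L) x = q x * formalPower f 0 x) ∧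
    (∀ x ∈ Set.Icc (0 : ℝ) L,
      iteratedDerivWithin 2 (formalPower f 1) (Set.Icc 0 L) x = q x * formalPower f 1 x) ∧
    (∀ n : ℕ, 2 ≤ n → ∀ x ∈ Set.Icc (0 : ℝ) L,
      iteratedDerivWithin 2 (formalPower f n) (Set.Icc 0 L) x - q x * formalPower f n x
        = (n : ℂ) * ((n : ℂ) - 1) * formalPower f (n - 2) x) := by
  have cf : ContinuousOn f (Set.Icc 0 L) := fun x hx => (hf x hx).continuousWithinAt
  have h0 : ContDiffOn ℝ 2 (formalPower f 0) (Set.Icc 0 L) ∧ ∀ x ∈ Set.Icc (0 : ℝ) L,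
      iteratedDerivWithin 2 (formalPower f 0) (Set.Icc 0 L) x = q x * formalPower f 0 x := by
    have e : formalPower f 0 = f := by
      funext x; simp [formalPower, Xeven]
    rw [e]
    exact aux_cd hL hf hf' (hq.mul cf)
  have h1 : ContDiffOn ℝ 2 (formalPower f 1) (Set.Icc 0 L) ∧ ∀ x ∈ Set.Icc (0 : ℝ) L,
      iteratedDerivWithin 2 (formalPower f 1) (Set.Icc 0 L) x = q x * formalPower f 1 x := by
    have e : formalPower f 1 = fun x => f x * Xodd f 1 x := by
      funext x; simp [formalPower]
    rw [e]
    have := aux_core hL (X := Xodd f 1) (Y := fun _ => 1) (W := fun _ => 0) (c := 1)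
      hq hf hf' hfne
      (fun x hx => ((aux_Xodd cf hfne 0).2 x hx).congr_deriv (by simp [Xodd]))
      (fun x hx => (hasDerivWithinAt_const x _ (1:ℂ)).congr_deriv (by simp))
      continuousOn_const
    simpa using this
  have h2 : ∀ n : ℕ, ContDiffOn ℝ 2 (formalPower f (n+2)) (Set.Icc 0 L) ∧
      ∀ x ∈ Set.Icc (0 : ℝ) L, iteratedDerivWithin 2 (formalPower f (n+2)) (Set.Icc 0 L) x
        = q x * formalPower f (n+2) x + ((n:ℂ)+2) * ((n:ℂ)+1) * formalPower f n x := by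
    intro n
    rcases Nat.even_or_odd n with hn | hn
    · have hn2 : Even (n+2) := hn.add (by decide)
      have e : formalPower f (n+2) = fun x => f x * Xeven f (n+2) x := by
        funext x; simp [formalPower, Nat.not_odd_iff_even.2 hn2]
      have e' : ∀ x, formalPower f n x = f x * Xeven f n x := by
        intro x; simp [formalPower, Nat.not_odd_iff_even.2 hn]
      simp only [e, e']
      obtain ⟨a, b⟩ := aux_core hL (X := Xeven f (n+2)) (Y := Xeven f (n+1))
        (W := fun x => ((n:ℂ)+1) * Xeven f n x) (c := (n:ℂ)+2) hq hf hf' hfne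
        (fun x hx => ((aux_Xeven cf hfne (n+1)).2 x hx).congr_deriv (by
          rw [hn.add_one.neg_one_pow, zpow_neg_one]; push_cast; ring))
        (fun x hx => ((aux_Xeven cf hfne n).2 x hx).congr_deriv (by
          rw [hn.neg_one_pow, zpow_one]; ring))
        (continuousOn_const.mul (aux_Xeven cf hfne n).1)
      refine ⟨a, fun x hx => ?_⟩
      rw [b x hx]; ring
    · have hn2 : Odd (n+2) := hn.add_even (by decide)
      have e : formalPower f (n+2) = fun x => f x * Xodd f (n+2) x := by
        funext x; simp only [formalPower, hn2, if_true]
      have e' : ∀ x, formalPower f n x = f x * Xodd f n x := by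
        intro x; simp only [formalPower, hn, if_true]
      simp only [e, e']
      obtain ⟨a, b⟩ := aux_core hL (X := Xodd f (n+2)) (Y := Xodd f (n+1))
        (W := fun x => ((n:ℂ)+1) * Xodd f n x) (c := (n:ℂ)+2) hq hf hf' hfne
        (fun x hx => ((aux_Xodd cf hfne (n+1)).2 x hx).congr_deriv (by
          rw [show n + 1 + 1 = n + 2 from rfl, hn2.neg_one_pow, zpow_neg_one]; push_cast; ring))
        (fun x hx => ((aux_Xodd cf hfne n).2 x hx).congr_deriv (by
          rw [hn.add_one.neg_one_pow, zpow_one]; ring))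
        (continuousOn_const.mul (aux_Xodd cf hfne n).1)
      refine ⟨a, fun x hx => ?_⟩
      rw [b x hx]; ring
  refine ⟨fun n => ?_, h0.2, h1.2, fun n hn x hx => ?_⟩
  · match n with
    | 0 => exact h0.1
    | 1 => exact h1.1
    | n+2 => exact (h2 n).1
  · obtain ⟨m, rfl⟩ := Nat.exists_eq_add_of_le' hn
    rw [(h2 m).2 x hx, Nat.add_sub_cancel]
    push_cast
    ring
end

section
/- Let L > 0, let q : [0,L] → ℂ be continuous, let f : [0,L] → ℂ be a twice continuously differentiable nonvanishing solution of f'' = q f with f(0) = 1, and let K ∈ C¹([0,L] × [−L,L]) be a kernel such that the operator (T u)(x) = u(x) + ∫_{−x}^{x} K(x,y) u(y) dy satisfies (T u)'' − q · (T u) = T(u'') for all u ∈ C²[0,L] and T[1] = f. Then for every natural number n and all x ∈ [0,L]: x^n + ∫_{−x}^{x} K(x,y) y^n dy = φ_n(x), where φ_n is the n-th formal power associated with f. -/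
/-- `K` is a transmutation kernel for the potential `q` and the solution `f`:
`K` is `C¹` on `[0,L] × [-L,L]`, the Volterra operator
`(T u)(x) = u(x) + ∫_{-x}^x K(x,y) u(y) dy` intertwines `d²/dx² - q` with
`d²/dx²` on twice continuously differentiable functions, and `T[1] = f`. -/
def IsTransmutationKernel (L : ℝ) (q f : ℝ → ℂ) (K : ℝ → ℝ → ℂ) : Prop :=
  ContDiffOn ℝ 1 (fun p : ℝ × ℝ => K p.1 p.2) (Set.Icc 0 L ×ˢ Set.Icc (-L) L) ∧
  (∀ u u' u'' : ℝ → ℂ,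
      (∀ y ∈ Set.Icc (-L) L, HasDerivWithinAt u (u' y) (Set.Icc (-L) L) y) →
      (∀ y ∈ Set.Icc (-L) L, HasDerivWithinAt u' (u'' y) (Set.Icc (-L) L) y) →
      ContinuousOn u'' (Set.Icc (-L) L) →
      ContDiffOn ℝ 2 (fun x => u x + ∫ y in (-x)..x, K x y * u y) (Set.Icc 0 L) ∧
      ∀ x ∈ Set.Icc (0 : ℝ) L,
        iteratedDerivWithin 2 (fun x' => u x' + ∫ y in (-x')..x', K x' y * u y)
            (Set.Icc 0 L) x
          - q x * (u x + ∫ y in (-x)..x, K x y * u y)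
          = u'' x + ∫ y in (-x)..x, K x y * u'' y) ∧
  (∀ x ∈ Set.Icc (0 : ℝ) L, 1 + ∫ y in (-x)..x, K x y = f x)


open MeasureTheory Set Filter Topology

lemma prim_cont (L : ℝ) (hL : 0 < L) (g : ℝ → ℂ) (hg : ContinuousOn g (Icc 0 L)) :
    ContinuousOn (fun x => ∫ s in (0:ℝ)..x, g s) (Icc 0 L) := by
  have h := intervalIntegral.continuousOn_primitive_interval (μ := volume) (f := g) (a := 0) (b := L)
    (by rw [uIcc_of_le hL.le]; exact hg.integrableOn_Icc)
  rwa [uIcc_of_le hL.le] at h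

lemma zpow_cont (L : ℝ) (f : ℝ → ℂ) (hf : ContinuousOn f (Icc 0 L))
    (hfne : ∀ x ∈ Icc (0 : ℝ) L, f x ≠ 0) (k : ℤ) :
    ContinuousOn (fun s => (f s ^ 2) ^ k) (Icc 0 L) := by
  apply (hf.pow 2).zpow₀
  intro x hx
  exact Or.inl (pow_ne_zero _ (hfne x hx))

lemma Xodd_cont (L : ℝ) (hL : 0 < L) (f : ℝ → ℂ) (hf : ContinuousOn f (Icc 0 L))
    (hfne : ∀ x ∈ Icc (0 : ℝ) L, f x ≠ 0) (n : ℕ) : ContinuousOn (Xodd f n) (Icc 0 L) := by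
  induction n with
  | zero => exact continuousOn_const.congr (fun x _ => by simp only [Xodd]; rfl)
  | succ n ih =>
    have := (continuousOn_const (c := (n + 1 : ℂ))).mul
      (prim_cont L hL _ (ih.mul (zpow_cont L f hf hfne ((-1 : ℤ) ^ (n + 1)))))
    exact this.congr (fun x _ => by simp only [Xodd]; rfl)

lemma Xeven_cont (L : ℝ) (hL : 0 < L) (f : ℝ → ℂ) (hf : ContinuousOn f (Icc 0 L))
    (hfne : ∀ x ∈ Icc (0 : ℝ) L, f x ≠ 0) (n : ℕ) : ContinuousOn (Xeven f n) (Icc 0 L) := by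
  induction n with
  | zero => exact continuousOn_const.congr (fun x _ => by simp only [Xeven]; rfl)
  | succ n ih =>
    have := (continuousOn_const (c := (n + 1 : ℂ))).mul
      (prim_cont L hL _ (ih.mul (zpow_cont L f hf hfne ((-1 : ℤ) ^ n))))
    exact this.congr (fun x _ => by simp only [Xeven]; rfl)

lemma formal_step (L : ℝ) (hL : 0 < L) (f : ℝ → ℂ) (hf : ContinuousOn f (Icc 0 L))
    (hfne : ∀ x ∈ Icc (0 : ℝ) L, f x ≠ 0) (m : ℕ) :
    ∃ A : ℝ → ℂ, ContinuousOn A (Icc 0 L) ∧ (∀ x, formalPower f m x = f x * A x) ∧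
      ∀ x, formalPower f (m + 2) x = f x * ∫ s in (0:ℝ)..x,
        (0 + ∫ t in (0:ℝ)..s, (((m:ℂ) + 2) * ((m:ℂ) + 1) * A t) * f t ^ 2) * (f s ^ 2)⁻¹ := by
  have key : ∀ (A : ℝ → ℂ) (x : ℝ), ((m:ℂ) + 1 + 1) * (∫ s in (0:ℝ)..x,
      (((m:ℂ) + 1) * ∫ t in (0:ℝ)..s, A t * f t ^ 2) * (f s ^ 2)⁻¹) = ∫ s in (0:ℝ)..x,
        (0 + ∫ t in (0:ℝ)..s, (((m:ℂ) + 2) * ((m:ℂ) + 1) * A t) * f t ^ 2) * (f s ^ 2)⁻¹ := by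
    intro A x
    rw [← intervalIntegral.integral_const_mul]
    congr 1
    funext s
    simp only [mul_assoc, intervalIntegral.integral_const_mul]
    ring
  rcases Nat.even_or_odd m with hm | hm
  · have h1 : ¬ Odd m := by simpa using hm
    have h2 : ¬ Odd (m + 2) := by simpa [Nat.even_add] using hm
    have e1 : (-1 : ℤ) ^ m = 1 := hm.neg_one_pow
    have e2 : (-1 : ℤ) ^ (m + 1) = -1 := (hm.add_one).neg_one_pow
    refine ⟨Xeven f m, Xeven_cont L hL f hf hfne m, fun x => by simp [formalPower, h1], ?_⟩
    intro x
    rw [← key, formalPower, if_neg h2]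
    simp only [Xeven, e1, e2, zpow_one, zpow_neg]
    push_cast
    rfl
  · have h2 : Odd (m + 2) := by
      rcases hm with ⟨k, rfl⟩; exact ⟨k + 1, by ring⟩
    have e1 : (-1 : ℤ) ^ (m + 1) = 1 := (hm.add_one).neg_one_pow
    have e2 : (-1 : ℤ) ^ (m + 1 + 1) = -1 := h2.neg_one_pow
    refine ⟨Xodd f m, Xodd_cont L hL f hf hfne m, fun x => by simp [formalPower, hm], ?_⟩
    intro x
    rw [← key, formalPower, if_pos h2]
    simp only [Xodd, e1, e2, zpow_one, zpow_neg]
    push_cast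
    rfl

lemma ftc (L : ℝ) (F F' : ℝ → ℂ) 
    (h : ∀ x ∈ Icc (0 : ℝ) L, HasDerivWithinAt F (F' x) (Icc 0 L) x)
    (hc : ContinuousOn F' (Icc 0 L)) (x : ℝ) (hx : x ∈ Icc (0 : ℝ) L) :
    ∫ s in (0:ℝ)..x, F' s = F x - F 0 := by
  have hsub : Icc 0 x ⊆ Icc 0 L := Icc_subset_Icc_right hx.2
  apply intervalIntegral.integral_eq_sub_of_hasDerivAt_of_le hx.1
  · exact fun y hy => ((h y (hsub hy)).continuousWithinAt).mono hsub
  · intro y hy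
    exact (h y (hsub (Ioo_subset_Icc_self hy))).hasDerivAt
      (Icc_mem_nhds hy.1 (hy.2.trans_le hx.2))
  · apply ContinuousOn.intervalIntegrable
    rw [uIcc_of_le hx.1]
    exact hc.mono hsub

lemma core (L : ℝ) (hL : 0 < L) (q f f' : ℝ → ℂ)
    (hf : ∀ x ∈ Icc (0 : ℝ) L, HasDerivWithinAt f (f' x) (Icc 0 L) x)
    (hf' : ∀ x ∈ Icc (0 : ℝ) L, HasDerivWithinAt f' (q x * f x) (Icc 0 L) x)
    (hf0 : f 0 = 1)
    (hfne : ∀ x ∈ Icc (0 : ℝ) L, f x ≠ 0)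
    (w g A : ℝ → ℂ) (b : ℂ)
    (hA : ContinuousOn A (Icc 0 L))
    (hw : ∀ x ∈ Icc (0 : ℝ) L, HasDerivWithinAt w (g x) (Icc 0 L) x)
    (hg : ∀ x ∈ Icc (0 : ℝ) L, HasDerivWithinAt g (q x * w x + f x * A x) (Icc 0 L) x)
    (hw0 : w 0 = 0) (hg0 : g 0 = b) (x : ℝ) (hx : x ∈ Icc (0 : ℝ) L) :
    w x = f x * ∫ s in (0:ℝ)..x, (b + ∫ t in (0:ℝ)..s, A t * f t ^ 2) * (f s ^ 2)⁻¹ := by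
  have cf : ContinuousOn f (Icc 0 L) := fun y hy => (hf y hy).continuousWithinAt
  have cf' : ContinuousOn f' (Icc 0 L) := fun y hy => (hf' y hy).continuousWithinAt
  have cw : ContinuousOn w (Icc 0 L) := fun y hy => (hw y hy).continuousWithinAt
  have cg : ContinuousOn g (Icc 0 L) := fun y hy => (hg y hy).continuousWithinAt
  have h1 : ∀ s ∈ Icc (0:ℝ) L, f s * g s - f' s * w s = b + ∫ t in (0:ℝ)..s, A t * f t ^ 2 := by
    intro s hs
    have hD : ∀ y ∈ Icc (0:ℝ) L, HasDerivWithinAt (fun s => f s * g s - f' s * w s)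
        (A y * f y ^ 2) (Icc 0 L) y := by
      intro y hy
      refine (((hf y hy).mul (hg y hy)).sub ((hf' y hy).mul (hw y hy))).congr_deriv ?_
      ring
    have h := ftc L _ _ hD (hA.mul (cf.pow 2)) s hs
    rw [h, hw0, hg0, hf0]
    ring
  have hD : ∀ y ∈ Icc (0:ℝ) L, HasDerivWithinAt (fun s => w s / f s)
      ((f y * g y - f' y * w y) * (f y ^ 2)⁻¹) (Icc 0 L) y := by
    intro y hy
    refine ((hw y hy).div (hf y hy) (hfne y hy)).congr_deriv ?_
    rw [div_eq_mul_inv]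
    ring
  have cc : ContinuousOn (fun s => (f s * g s - f' s * w s) * (f s ^ 2)⁻¹) (Icc 0 L) :=
    ((cf.mul cg).sub (cf'.mul cw)).mul ((cf.pow 2).inv₀ (fun y hy => pow_ne_zero _ (hfne y hy)))
  have h2 := ftc L _ _ hD cc x hx
  have h3 : ∫ s in (0:ℝ)..x, (b + ∫ t in (0:ℝ)..s, A t * f t ^ 2) * (f s ^ 2)⁻¹ = w x / f x := by
    rw [show w x / f x = w x / f x - w 0 / f 0 by simp [hw0], ← h2]
    apply intervalIntegral.integral_congr
    intro s hs
    rw [uIcc_of_le hx.1] at hs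
    simp only
    rw [h1 s (Icc_subset_Icc_right hx.2 hs)]
  rw [h3, mul_div_cancel₀ _ (hfne x hx)]

lemma deriv_integral_zero (L : ℝ) (hL : 0 < L) (K : ℝ → ℝ → ℂ)
    (hK : ContinuousOn (fun p : ℝ × ℝ => K p.1 p.2) (Icc 0 L ×ˢ Icc (-L) L)) (m : ℕ) :
    HasDerivWithinAt (fun x : ℝ => ∫ y in (-x)..x, K x y * (y : ℂ) ^ (m + 1)) 0 (Icc 0 L) 0 := by
  obtain ⟨C, hC⟩ := (isCompact_Icc.prod isCompact_Icc).exists_bound_of_continuousOn hK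
  have hO : (fun x : ℝ => ∫ y in (-x)..x, K x y * (y : ℂ) ^ (m + 1))
      =O[𝓝[Icc 0 L] 0] (fun x : ℝ => ‖x - 0‖ ^ 2) := by
    apply Asymptotics.IsBigO.of_bound (C * L ^ m * 2)
    filter_upwards [self_mem_nhdsWithin] with x hx
    have hb : ∀ y ∈ uIoc (-x) x, ‖K x y * (y : ℂ) ^ (m + 1)‖ ≤ C * (L ^ m * x) := by
      intro y hy
      rw [uIoc_of_le (by linarith [hx.1])] at hy
      have hy' : |y| ≤ x := abs_le.2 ⟨hy.1.le, hy.2⟩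
      have hc := hC (x, y) ⟨hx, ⟨by linarith [hy.1, hx.2], by linarith [hy.2, hx.2]⟩⟩
      have hc0 : 0 ≤ C := (norm_nonneg _).trans hc
      rw [norm_mul, norm_pow, Complex.norm_real, Real.norm_eq_abs, pow_succ]
      have := hx.2
      have := hx.1
      have hyL : |y| ≤ L := by linarith
      have hc' : ‖K x y‖ ≤ C := hc
      gcongr
    have := intervalIntegral.norm_integral_le_of_norm_le_const hb
    refine this.trans (le_of_eq ?_)
    have : |x - -x| = 2 * x := by rw [abs_of_nonneg] <;> linarith [hx.1]
    rw [this]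
    simp
    ring
  have := hO.hasFDerivWithinAt (𝕜 := ℝ) (left_mem_Icc.2 hL.le) (by norm_num)
  simpa using this.hasDerivWithinAt

lemma smooth_ders (L : ℝ) (hL : 0 < L) (w : ℝ → ℂ) (h : ContDiffOn ℝ 2 w (Icc 0 L)) :
    (∀ x ∈ Icc (0 : ℝ) L, HasDerivWithinAt w (derivWithin w (Icc 0 L) x) (Icc 0 L) x) ∧
    (∀ x ∈ Icc (0 : ℝ) L, HasDerivWithinAt (derivWithin w (Icc 0 L))
      (iteratedDerivWithin 2 w (Icc 0 L) x) (Icc 0 L) x) := by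
  have hu : UniqueDiffOn ℝ (Icc 0 L) := uniqueDiffOn_Icc hL
  constructor
  · intro x hx
    exact ((h.differentiableOn (by norm_num)) x hx).hasDerivWithinAt
  · intro x hx
    have h1 : ContDiffOn ℝ 1 (derivWithin w (Icc 0 L)) (Icc 0 L) :=
      h.derivWithin hu (by norm_num)
    have h2 := ((h1.differentiableOn (by norm_num)) x hx).hasDerivWithinAt
    refine h2.congr_deriv ?_
    symm
    rw [iteratedDerivWithin_succ, iteratedDerivWithin_one]

/-- The transmutation operator maps `x^n` to the formal power `φ_n`:
`x^n + ∫_{-x}^x K(x,y) y^n dy = φ_n(x)` for all `n ∈ ℕ` and `x ∈ [0,L]`. -/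
theorem transmutation_maps_powers_to_formal_powers (L : ℝ) (hL : 0 < L)
    (q f f' : ℝ → ℂ)
    (hq : ContinuousOn q (Set.Icc 0 L))
    (hf : ∀ x ∈ Set.Icc (0 : ℝ) L, HasDerivWithinAt f (f' x) (Set.Icc 0 L) x)
    (hf' : ∀ x ∈ Set.Icc (0 : ℝ) L, HasDerivWithinAt f' (q x * f x) (Set.Icc 0 L) x)
    (hf0 : f 0 = 1)
    (hfne : ∀ x ∈ Set.Icc (0 : ℝ) L, f x ≠ 0)
    (K : ℝ → ℝ → ℂ) (hK : IsTransmutationKernel L q f K) :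
    ∀ n : ℕ, ∀ x ∈ Set.Icc (0 : ℝ) L,
      (x : ℂ) ^ n + (∫ y in (-x)..x, K x y * (y : ℂ) ^ n) = formalPower f n x := by
  have cf : ContinuousOn f (Icc 0 L) := fun y hy => (hf y hy).continuousWithinAt
  obtain ⟨hK1, hK2, hK3⟩ := hK
  have h0mem : (0:ℝ) ∈ Icc 0 L := left_mem_Icc.2 hL.le
  have hpow : ∀ (k : ℕ) (y : ℝ) (s : Set ℝ), HasDerivWithinAt (fun y : ℝ => (y : ℂ) ^ (k + 1))
      (((k : ℂ) + 1) * (y : ℂ) ^ k) s y := by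
    intro k y s
    have := ((hasDerivAt_id y).ofReal_comp.pow (k + 1)).hasDerivWithinAt (s := s)
    refine this.congr_deriv ?_
    simp
  have hd0 : ∀ m : ℕ, derivWithin (fun x : ℝ => (x : ℂ) ^ (m + 1)
      + ∫ y in (-x)..x, K x y * (y : ℂ) ^ (m + 1)) (Icc 0 L) 0 = ((m : ℂ) + 1) * (0 : ℂ) ^ m := by
    intro m
    have := (hpow m 0 (Icc 0 L)).add (deriv_integral_zero L hL K hK1.continuousOn m)
    have h := this.derivWithin (uniqueDiffOn_Icc hL 0 h0mem)
    exact h.trans (by simp)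
  intro n
  induction n using Nat.twoStepInduction with
  | zero =>
    intro x hx
    simpa [formalPower, Xeven] using hK3 x hx
  | one =>
    intro x hx
    obtain ⟨c, e⟩ := hK2 (fun y => (y : ℂ) ^ (0 + 1)) (fun _ => 1) (fun _ => 0)
      (fun y _ => by simpa using hpow 0 y (Icc (-L) L))
      (fun y _ => hasDerivWithinAt_const _ _ _) continuousOn_const
    obtain ⟨d1, d2⟩ := smooth_ders L hL _ c
    have := core L hL q f f' hf hf' hf0 hfne _ _ (fun _ => 0) 1 continuousOn_const d1
      (fun y hy => by
        refine (d2 y hy).congr_deriv ?_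
        have := e y hy
        rw [sub_eq_iff_eq_add] at this
        rw [this]
        simp) (by simp) (by rw [hd0 0]; simp) x hx
    simp only [zero_add] at this
    rw [this]
    simp [formalPower, Xodd]
  | more m ih _ =>
    intro x hx
    obtain ⟨A, hA, hA1, hA2⟩ := formal_step L hL f cf hfne m
    obtain ⟨c, e⟩ := hK2 (fun y => (y : ℂ) ^ (m + 1 + 1))
      (fun y => ((m : ℂ) + 2) * (y : ℂ) ^ (m + 1))
      (fun y => ((m : ℂ) + 2) * (((m : ℂ) + 1) * (y : ℂ) ^ m))
      (fun y _ => by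
        refine (hpow (m + 1) y (Icc (-L) L)).congr_deriv ?_
        push_cast
        ring)
      (fun y _ => (hpow m y (Icc (-L) L)).const_mul _)
      (by fun_prop)
    obtain ⟨d1, d2⟩ := smooth_ders L hL _ c
    have := core L hL q f f' hf hf' hf0 hfne _ _
      (fun t => ((m : ℂ) + 2) * ((m : ℂ) + 1) * A t) 0 (continuousOn_const.mul hA) d1
      (fun y hy => by
        refine (d2 y hy).congr_deriv ?_
        have h := e y hy
        rw [sub_eq_iff_eq_add] at h
        rw [h]
        have h4 : ∫ z in (-y)..y, K y z * (((m : ℂ) + 2) * (((m : ℂ) + 1) * (z : ℂ) ^ m))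
            = ((m : ℂ) + 2) * ((m : ℂ) + 1) * ∫ z in (-y)..y, K y z * (z : ℂ) ^ m := by
          rw [← intervalIntegral.integral_const_mul]
          congr 1
          funext z
          ring
        have h5 := ih y hy
        rw [hA1] at h5
        rw [h4]
        linear_combination (((m : ℂ) + 2) * ((m : ℂ) + 1)) * h5) (by simp)
        (by rw [hd0 (m + 1)]; simp) x hx
    rw [hA2]
    exact this
end

section
/- Let L > 0, T > 0, let q : [0,L] → ℝ be continuous, let f be a twice continuously differentiable nonvanishing solution of f'' = q f on [0,L] with f(0) = 1, and let H_n(x,t) = Σ_{k=0}^{⌊n/2⌋} c_k^n φ_{n−2k}(x) t^k be the transmuted heat polynomials built from the formal powers φ_m associated with f. Let s ∈ C¹[0,T] with 0 < s(t) ≤ L for all t ∈ [0,T) and let D(s) = {(x,t) ∈ ℝ² : 0 < x < s(t), 0 < t < T}. Let u be continuous on the closure of D(s) and satisfy u_xx(x,t) − q(x) u(x,t) = u_t(x,t) classically at every point of D(s) (the partial derivatives u_x, u_xx, u_t exist and are continuous in D(s)). Then for every compact set D_c ⊂ D(s) and every ε > 0 there exist N ∈ ℕ and constants a_0, …, a_N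 such that max_{(x,t) ∈ D_c} |u(x,t) − Σ_{n=0}^{N} a_n H_n(x,t)| < ε. -/
/-- The coefficient `c_k^n = n! / ((n - 2k)! k!)` of the heat polynomial. -/
noncomputable def heatCoeff (n k : ℕ) : ℝ :=
  (Nat.factorial n : ℝ) / ((Nat.factorial (n - 2 * k) : ℝ) * (Nat.factorial k : ℝ))

/-- The recursive integrals `X^{(n)}` : `X^{(0)} ≡ 1`,
`X^{(n)}(x) = n ∫_0^x X^{(n-1)}(s) (f²(s))^{(-1)^n} ds`. -/
noncomputable def XoddR (f : ℝ → ℝ) : ℕ → ℝ → ℝ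
  | 0, _ => 1
  | n + 1, x =>
      (n + 1 : ℝ) * ∫ s in (0 : ℝ)..x, XoddR f n s * (f s ^ 2) ^ ((-1 : ℤ) ^ (n + 1))

/-- The recursive integrals `X̃^{(n)}` : `X̃^{(0)} ≡ 1`,
`X̃^{(n)}(x) = n ∫_0^x X̃^{(n-1)}(s) (f²(s))^{(-1)^{n-1}} ds`. -/
noncomputable def XevenR (f : ℝ → ℝ) : ℕ → ℝ → ℝ
  | 0, _ => 1
  | n + 1, x =>
      (n + 1 : ℝ) * ∫ s in (0 : ℝ)..x, XevenR f n s * (f s ^ 2) ^ ((-1 : ℤ) ^ n)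

/-- The formal powers associated with `f`: `φ_n = f X^{(n)}` for odd `n` and
`φ_n = f X̃^{(n)}` for even `n`. -/
noncomputable def formalPowerR (f : ℝ → ℝ) (n : ℕ) (x : ℝ) : ℝ :=
  if Odd n then f x * XoddR f n x else f x * XevenR f n x

/-- The transmuted heat polynomial
`H_n(x,t) = Σ_{k=0}^{⌊n/2⌋} c_k^n φ_{n-2k}(x) t^k`. -/
noncomputable def transmutedHeatPolyR (f : ℝ → ℝ) (n : ℕ) (x t : ℝ) : ℝ :=
  ∑ k ∈ Finset.range (n / 2 + 1),
    heatCoeff n k * formalPowerR f (n - 2 * k) x * t ^ k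

/-! ### The Volterra operator -/

/-- The right inverse of `d²/dx² - q` with zero Cauchy data at `0`. -/
noncomputable def Sop (f w : ℝ → ℝ) (x : ℝ) : ℝ :=
  f x * ∫ y in (0 : ℝ)..x, (f y ^ 2)⁻¹ * ∫ z in (0 : ℝ)..y, f z * w z

/-- The first formal power. -/
noncomputable def phiOne (f : ℝ → ℝ) (x : ℝ) : ℝ :=
  f x * ∫ y in (0 : ℝ)..x, (f y ^ 2)⁻¹

theorem continuous_prim {g : ℝ → ℝ} (hg : Continuous g) :
    Continuous (fun x => ∫ y in (0 : ℝ)..x, g y) :=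
  intervalIntegral.continuous_primitive (fun _ _ => hg.intervalIntegrable _ _) 0

theorem Sop_continuous {f w : ℝ → ℝ} (hf : Continuous f) (hne : ∀ x, f x ≠ 0)
    (hw : Continuous w) : Continuous (Sop f w) := by
  have h1 := continuous_prim (hf.mul hw)
  have h2 : Continuous (fun y => (f y ^ 2)⁻¹) :=
    (hf.pow 2).inv₀ (fun x => pow_ne_zero _ (hne x))
  exact hf.mul (continuous_prim (h2.mul h1))

theorem phiOne_continuous {f : ℝ → ℝ} (hf : Continuous f) (hne : ∀ x, f x ≠ 0) :
    Continuous (phiOne f) := by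
  have h2 : Continuous (fun y => (f y ^ 2)⁻¹) :=
    (hf.pow 2).inv₀ (fun x => pow_ne_zero _ (hne x))
  exact hf.mul (continuous_prim h2)

theorem Sop_lin {f w v : ℝ → ℝ} (hf : Continuous f) (hne : ∀ x, f x ≠ 0)
    (hw : Continuous w) (hv : Continuous v) (a b : ℝ) (x : ℝ) :
    Sop f (fun z => a * w z + b * v z) x = a * Sop f w x + b * Sop f v x := by
  have h2 : Continuous (fun y => (f y ^ 2)⁻¹) :=
    (hf.pow 2).inv₀ (fun x => pow_ne_zero _ (hne x))
  have hw1 := continuous_prim (hf.mul hw)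
  have hv1 := continuous_prim (hf.mul hv)
  have e1 : ∀ y, ∫ z in (0 : ℝ)..y, f z * (a * w z + b * v z)
      = a * (∫ z in (0 : ℝ)..y, f z * w z) + b * ∫ z in (0 : ℝ)..y, f z * v z := by
    intro y
    rw [← intervalIntegral.integral_const_mul, ← intervalIntegral.integral_const_mul,
      ← intervalIntegral.integral_add]
    · congr 1; ext z; ring
    · exact ((hf.mul hw).const_mul a).intervalIntegrable _ _
    · exact ((hf.mul hv).const_mul b).intervalIntegrable _ _
  unfold Sop
  simp only [e1]
  have e2 : ∫ y in (0 : ℝ)..x, (f y ^ 2)⁻¹ * (a * (∫ z in (0 : ℝ)..y, f z * w z)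
        + b * ∫ z in (0 : ℝ)..y, f z * v z)
      = a * (∫ y in (0 : ℝ)..x, (f y ^ 2)⁻¹ * ∫ z in (0 : ℝ)..y, f z * w z)
        + b * ∫ y in (0 : ℝ)..x, (f y ^ 2)⁻¹ * ∫ z in (0 : ℝ)..y, f z * v z := by
    rw [← intervalIntegral.integral_const_mul, ← intervalIntegral.integral_const_mul,
      ← intervalIntegral.integral_add]
    · congr 1; ext z; ring
    · exact ((h2.mul hw1).const_mul a).intervalIntegrable _ _
    · exact ((h2.mul hv1).const_mul b).intervalIntegrable _ _
  rw [e2]; ring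

theorem Sop_zero (f : ℝ → ℝ) : Sop f (fun _ => 0) = fun _ => 0 := by
  ext x; simp [Sop]

theorem Sop_sum {f : ℝ → ℝ} (hf : Continuous f) (hne : ∀ x, f x ≠ 0)
    (N : ℕ) (c : ℕ → ℝ) (w : ℕ → ℝ → ℝ) (hw : ∀ j, Continuous (w j)) (x : ℝ) :
    Sop f (fun z => ∑ j ∈ Finset.range N, c j * w j z) x
      = ∑ j ∈ Finset.range N, c j * Sop f (w j) x := by
  induction N with
  | zero => simp [Sop_zero]
  | succ n ih =>
    simp only [Finset.sum_range_succ]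
    rw [← ih]
    have := Sop_lin hf hne (w := fun z => ∑ j ∈ Finset.range n, c j * w j z) (v := w n)
      (continuous_finsetSum _ fun j _ => (hw j).const_mul _) (hw n) 1 (c n) x
    simpa using this

theorem Sop_congr {f w v : ℝ → ℝ} {b : ℝ} (h : ∀ x ∈ Set.Icc 0 b, w x = v x) :
    ∀ x ∈ Set.Icc 0 b, Sop f w x = Sop f v x := by
  intro x hx
  unfold Sop
  congr 1
  apply intervalIntegral.integral_congr
  intro y hy
  rw [Set.uIcc_of_le hx.1] at hy
  simp only
  congr 1
  apply intervalIntegral.integral_congr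
  intro z hz
  rw [Set.uIcc_of_le hy.1] at hz
  simp only
  rw [h z ⟨hz.1, hz.2.trans (hy.2.trans hx.2)⟩]

theorem Sop_iter_continuous {f w : ℝ → ℝ} (hf : Continuous f) (hne : ∀ x, f x ≠ 0)
    (hw : Continuous w) (n : ℕ) : Continuous ((Sop f)^[n] w) := by
  induction n with
  | zero => simpa
  | succ n ih => rw [Function.iterate_succ_apply']; exact Sop_continuous hf hne ih

theorem abs_prim_le {g : ℝ → ℝ} {c L : ℝ} {n : ℕ} (hg : Continuous g)
    (h : ∀ x ∈ Set.Icc 0 L, |g x| ≤ c * (x ^ n / n.factorial)) :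
    ∀ x ∈ Set.Icc 0 L, |∫ y in (0 : ℝ)..x, g y| ≤ c * (x ^ (n + 1) / (n + 1).factorial) := by
  intro x hx
  have h1 : |∫ y in (0 : ℝ)..x, g y| ≤ ∫ y in (0 : ℝ)..x, c * (y ^ n / n.factorial) := by
    refine (intervalIntegral.abs_integral_le_integral_abs hx.1).trans ?_
    apply intervalIntegral.integral_mono_on hx.1
    · exact hg.abs.intervalIntegrable _ _
    · exact (by fun_prop : Continuous fun y : ℝ => c * (y ^ n / n.factorial)).intervalIntegrable _ _
    · intro y hy; exact h y ⟨hy.1, hy.2.trans hx.2⟩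
  refine h1.trans (le_of_eq ?_)
  rw [intervalIntegral.integral_const_mul, intervalIntegral.integral_div, integral_pow,
    Nat.factorial_succ]
  push_cast
  have : (n.factorial : ℝ) ≠ 0 := by positivity
  have : (n : ℝ) + 1 ≠ 0 := by positivity
  field_simp
  simp

theorem Sop_bound {f w : ℝ → ℝ} (hf : Continuous f) (hne : ∀ x, f x ≠ 0)
    (hw : Continuous w) {c L M m : ℝ} {n : ℕ} (hM : ∀ x, |f x| ≤ M)
    (hm : ∀ x, |(f x ^ 2)⁻¹| ≤ m)
    (h : ∀ x ∈ Set.Icc 0 L, |w x| ≤ c * (x ^ n / n.factorial)) :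
    ∀ x ∈ Set.Icc 0 L, |Sop f w x| ≤ (M * m * M * c) * (x ^ (n + 2) / (n + 2).factorial) := by
  have hM0 : 0 ≤ M := (abs_nonneg _).trans (hM 0)
  have hm0 : 0 ≤ m := (abs_nonneg _).trans (hm 0)
  have h2 : Continuous (fun y => (f y ^ 2)⁻¹) :=
    (hf.pow 2).inv₀ (fun x => pow_ne_zero _ (hne x))
  have a1 := abs_prim_le (g := fun z => f z * w z) (c := M * c) (L := L) (n := n) (hf.mul hw)
    (by
      intro x hx
      rw [abs_mul, mul_assoc]
      exact mul_le_mul (hM x) (h x hx) (abs_nonneg _) hM0)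
  have a2 := abs_prim_le (g := fun y => (f y ^ 2)⁻¹ * ∫ z in (0 : ℝ)..y, f z * w z)
    (c := m * (M * c)) (L := L) (n := n + 1)
    (h2.mul (continuous_prim (hf.mul hw)))
    (by
      intro x hx
      rw [abs_mul, mul_assoc]
      exact mul_le_mul (hm x) (a1 x hx) (abs_nonneg _) hm0)
  intro x hx
  unfold Sop
  rw [abs_mul]
  calc _ ≤ M * _ := mul_le_mul (hM x) (a2 x hx) (abs_nonneg _) hM0
    _ = _ := by ring

theorem Sop_iter_bound {f w : ℝ → ℝ} (hf : Continuous f) (hne : ∀ x, f x ≠ 0)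
    (hw : Continuous w) {c L M m : ℝ} (hM : ∀ x, |f x| ≤ M)
    (hm : ∀ x, |(f x ^ 2)⁻¹| ≤ m)
    (h : ∀ x ∈ Set.Icc 0 L, |w x| ≤ c) (n : ℕ) :
    ∀ x ∈ Set.Icc 0 L, |(Sop f)^[n] w x| ≤
      ((M * m * M) ^ n * c) * (x ^ (2 * n) / (2 * n).factorial) := by
  induction n with
  | zero => simpa using h
  | succ n ih =>
    rw [Function.iterate_succ_apply']
    have := Sop_bound hf hne (Sop_iter_continuous hf hne hw n) hM hm ih
    intro x hx
    refine (this x hx).trans (le_of_eq ?_)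
    rw [show 2 * (n + 1) = 2 * n + 2 by ring]
    ring

theorem Sop_iter_bound' {f w : ℝ → ℝ} (hf : Continuous f) (hne : ∀ x, f x ≠ 0)
    (hw : Continuous w) {c L M m : ℝ} (hM : ∀ x, |f x| ≤ M)
    (hm : ∀ x, |(f x ^ 2)⁻¹| ≤ m) (b : ℝ) (hb : b ≤ L)
    (h : ∀ x ∈ Set.Icc 0 b, |w x| ≤ c) (n : ℕ) :
    ∀ x ∈ Set.Icc 0 b, |(Sop f)^[n] w x| ≤
      c * ((M * m * M * L ^ 2) ^ n / (2 * n).factorial) := by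
  intro x hx
  have hM0 : 0 ≤ M := (abs_nonneg _).trans (hM 0)
  have hm0 : 0 ≤ m := (abs_nonneg _).trans (hm 0)
  have hc : 0 ≤ c := (abs_nonneg _).trans (h x hx)
  refine (Sop_iter_bound hf hne hw hM hm h n x hx).trans ?_
  have h0 : x ^ (2 * n) ≤ L ^ (2 * n) := pow_le_pow_left₀ hx.1 (hx.2.trans hb) _
  calc _ ≤ ((M * m * M) ^ n * c) * (L ^ (2 * n) / (2 * n).factorial) := by gcongr
    _ = _ := by rw [mul_pow (M * m * M) (L ^ 2), ← pow_mul]; ring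

/-- Iterated expansion. -/
theorem Sop_expand {f : ℝ → ℝ} (hf : Continuous f) (hne : ∀ x, f x ≠ 0)
    (w : ℕ → ℝ → ℝ) (hw : ∀ k, Continuous (w k)) (α β : ℕ → ℝ) (b : ℝ)
    (h : ∀ k, ∀ x ∈ Set.Icc 0 b, w k x = α k * f x + β k * phiOne f x + Sop f (w (k + 1)) x)
    (n : ℕ) : ∀ k, ∀ x ∈ Set.Icc 0 b, w k x =
      ∑ i ∈ Finset.range n, (α (k + i) * (Sop f)^[i] f x + β (k + i) * (Sop f)^[i] (phiOne f) x)
        + (Sop f)^[n] (w (k + n)) x := by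
  induction n with
  | zero => intro k x hx; simp
  | succ n ih =>
    intro k x hx
    rw [h k x hx, Finset.sum_range_succ', Sop_congr (ih (k + 1)) x hx]
    have hc : ∀ j, Continuous (fun z => α (k + 1 + j) * (Sop f)^[j] f z
        + β (k + 1 + j) * (Sop f)^[j] (phiOne f) z) := fun j =>
      ((Sop_iter_continuous hf hne hf _).const_mul _).add
        ((Sop_iter_continuous hf hne (phiOne_continuous hf hne) _).const_mul _)
    have e := Sop_lin hf hne (w := fun z => ∑ i ∈ Finset.range n, (1:ℝ) *
      (α (k + 1 + i) * (Sop f)^[i] f z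
      + β (k + 1 + i) * (Sop f)^[i] (phiOne f) z)) (v := (Sop f)^[n] (w (k + 1 + n)))
      (continuous_finsetSum _ fun j _ => (hc j).const_mul _)
      (Sop_iter_continuous hf hne (hw _) _) 1 1 x
    rw [Sop_sum hf hne n (fun _ => 1) (fun j z => α (k + 1 + j) * (Sop f)^[j] f z
        + β (k + 1 + j) * (Sop f)^[j] (phiOne f) z) hc] at e
    simp only [one_mul] at e
    rw [e]
    simp only [Function.iterate_succ_apply', Sop_lin hf hne (Sop_iter_continuous hf hne hf _)
      (Sop_iter_continuous hf hne (phiOne_continuous hf hne) _)]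
    simp only [Function.iterate_zero, id, add_zero,
      show ∀ i, k + 1 + i = k + (i + 1) by intro i; ring]
    ring


/-! ### Formal powers and heat polynomials via the Volterra operator -/

theorem XoddR_congr {f g : ℝ → ℝ} {L : ℝ} (h : ∀ x ∈ Set.Icc 0 L, f x = g x) (n : ℕ) :
    ∀ x ∈ Set.Icc 0 L, XoddR f n x = XoddR g n x := by
  induction n with
  | zero => intro x _; simp [XoddR]
  | succ n ih =>
    intro x hx
    rw [XoddR, XoddR]
    congr 1
    apply intervalIntegral.integral_congr
    intro y hy
    rw [Set.uIcc_of_le hx.1] at hy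
    have hy' : y ∈ Set.Icc 0 L := ⟨hy.1, hy.2.trans hx.2⟩
    simp only
    rw [ih y hy', h y hy']

theorem XevenR_congr {f g : ℝ → ℝ} {L : ℝ} (h : ∀ x ∈ Set.Icc 0 L, f x = g x) (n : ℕ) :
    ∀ x ∈ Set.Icc 0 L, XevenR f n x = XevenR g n x := by
  induction n with
  | zero => intro x _; simp [XevenR]
  | succ n ih =>
    intro x hx
    rw [XevenR, XevenR]
    congr 1
    apply intervalIntegral.integral_congr
    intro y hy
    rw [Set.uIcc_of_le hx.1] at hy
    have hy' : y ∈ Set.Icc 0 L := ⟨hy.1, hy.2.trans hx.2⟩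
    simp only
    rw [ih y hy', h y hy']

theorem heatPoly_congr {f g : ℝ → ℝ} {L : ℝ} (h : ∀ x ∈ Set.Icc 0 L, f x = g x) (n : ℕ) (t : ℝ) :
    ∀ x ∈ Set.Icc 0 L, transmutedHeatPolyR f n x t = transmutedHeatPolyR g n x t := by
  intro x hx
  unfold transmutedHeatPolyR formalPowerR
  simp only [XoddR_congr h _ x hx, XevenR_congr h _ x hx, h x hx]

theorem XevenR_even {f : ℝ → ℝ} (hne : ∀ x, f x ≠ 0) (k : ℕ) :
    ∀ x, f x * XevenR f (2 * k) x = ((2 * k).factorial : ℝ) * (Sop f)^[k] f x := by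
  induction k with
  | zero => intro x; simp [XevenR]
  | succ k ih =>
    intro x
    have e1 : ∀ y, XevenR f (2 * k + 1) y =
        ((2 * k + 1).factorial : ℝ) * ∫ z in (0:ℝ)..y, f z * (Sop f)^[k] f z := by
      intro y
      rw [XevenR, Nat.factorial_succ]
      have : ∀ z, XevenR f (2 * k) z * (f z ^ 2) ^ ((-1 : ℤ) ^ (2 * k))
          = ((2 * k).factorial : ℝ) * (f z * (Sop f)^[k] f z) := by
        intro z
        rw [pow_mul]; simp only [even_two, Even.neg_pow, one_pow, zpow_one]
        have := ih z
        calc _ = f z * (f z * XevenR f (2 * k) z) := by ring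
          _ = _ := by rw [this]; ring
      simp only [this, intervalIntegral.integral_const_mul]
      push_cast; ring
    rw [Function.iterate_succ_apply', show 2 * (k + 1) = (2 * k + 1) + 1 by ring, XevenR,
      Nat.factorial_succ, Sop]
    have : ∀ z, XevenR f (2 * k + 1) z * (f z ^ 2) ^ ((-1 : ℤ) ^ (2 * k + 1))
        = ((2 * k + 1).factorial : ℝ) * ((f z ^ 2)⁻¹ * ∫ z in (0:ℝ)..z, f z * (Sop f)^[k] f z) := by
      intro z
      rw [e1, pow_succ (-1 : ℤ), pow_mul]
      simp only [even_two, Even.neg_pow, one_pow, one_mul, zpow_neg, zpow_one]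
      ring
    simp only [this, intervalIntegral.integral_const_mul]
    push_cast; ring

theorem XoddR_odd {f : ℝ → ℝ} (k : ℕ) :
    ∀ x, f x * XoddR f (2 * k + 1) x = ((2 * k + 1).factorial : ℝ) * (Sop f)^[k] (phiOne f) x := by
  induction k with
  | zero => intro x; simp [XoddR, phiOne]
  | succ k ih =>
    intro x
    have e1 : ∀ y, XoddR f (2 * k + 2) y =
        ((2 * k + 2).factorial : ℝ) * ∫ z in (0:ℝ)..y, f z * (Sop f)^[k] (phiOne f) z := by
      intro y
      rw [XoddR, Nat.factorial_succ]
      have : ∀ z, XoddR f (2 * k + 1) z * (f z ^ 2) ^ ((-1 : ℤ) ^ (2 * k + 1 + 1))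
          = ((2 * k + 1).factorial : ℝ) * (f z * (Sop f)^[k] (phiOne f) z) := by
        intro z
        rw [show 2 * k + 1 + 1 = 2 * (k + 1) by ring, pow_mul]
        simp only [even_two, Even.neg_pow, one_pow, zpow_one]
        have := ih z
        calc _ = f z * (f z * XoddR f (2 * k + 1) z) := by ring
          _ = _ := by rw [this]; ring
      simp only [this, intervalIntegral.integral_const_mul]
      push_cast; ring
    rw [Function.iterate_succ_apply', show 2 * (k + 1) + 1 = (2 * k + 2) + 1 by ring, XoddR,
      Nat.factorial_succ, Sop]
    have : ∀ z, XoddR f (2 * k + 2) z * (f z ^ 2) ^ ((-1 : ℤ) ^ (2 * k + 2 + 1))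
        = ((2 * k + 2).factorial : ℝ) *
          ((f z ^ 2)⁻¹ * ∫ z in (0:ℝ)..z, f z * (Sop f)^[k] (phiOne f) z) := by
      intro z
      rw [e1, show 2 * k + 2 + 1 = 2 * (k + 1) + 1 by ring, pow_succ (-1 : ℤ), pow_mul]
      simp only [even_two, Even.neg_pow, one_pow, one_mul, zpow_neg, zpow_one]
      ring
    simp only [this, intervalIntegral.integral_const_mul]
    push_cast; ring

theorem heatPoly_even {f : ℝ → ℝ} (hne : ∀ x, f x ≠ 0) (i : ℕ) (x t : ℝ) :
    transmutedHeatPolyR f (2 * i) x t = ((2 * i).factorial : ℝ) *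
      ∑ k ∈ Finset.range (i + 1), t ^ k / k.factorial * (Sop f)^[i - k] f x := by
  unfold transmutedHeatPolyR
  rw [Finset.mul_sum, show 2 * i / 2 + 1 = i + 1 by omega]
  apply Finset.sum_congr rfl
  intro k hk
  have hk : k ≤ i := by simp at hk; omega
  rw [show 2 * i - 2 * k = 2 * (i - k) by omega, formalPowerR, if_neg (by simp), XevenR_even hne,
    heatCoeff, show 2 * i - 2 * k = 2 * (i - k) by omega]
  have : ((2 * (i - k)).factorial : ℝ) ≠ 0 := by positivity
  field_simp

theorem heatPoly_odd {f : ℝ → ℝ} (i : ℕ) (x t : ℝ) :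
    transmutedHeatPolyR f (2 * i + 1) x t = ((2 * i + 1).factorial : ℝ) *
      ∑ k ∈ Finset.range (i + 1), t ^ k / k.factorial * (Sop f)^[i - k] (phiOne f) x := by
  unfold transmutedHeatPolyR
  rw [Finset.mul_sum, show (2 * i + 1) / 2 + 1 = i + 1 by omega]
  apply Finset.sum_congr rfl
  intro k hk
  have hk : k ≤ i := by simp at hk; omega
  rw [show 2 * i + 1 - 2 * k = 2 * (i - k) + 1 by omega, formalPowerR, if_pos (by simp), XoddR_odd,
    heatCoeff, show 2 * i + 1 - 2 * k = 2 * (i - k) + 1 by omega]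
  have : ((2 * (i - k) + 1).factorial : ℝ) ≠ 0 := by positivity
  field_simp

theorem sum_flip (N : ℕ) (a c e : ℕ → ℝ) (ha : ∀ i, N ≤ i → a i = 0) :
    ∑ k ∈ Finset.range N, (∑ j ∈ Finset.range N, c j * a (k + j)) * e k
      = ∑ i ∈ Finset.range N, a i * ∑ k ∈ Finset.range (i + 1), c k * e (i - k) := by
  have h := Finset.sum_range_diag_flip N (fun j k => c j * a (j + k) * e k)
  have h1 : ∑ i ∈ Finset.range N, a i * ∑ k ∈ Finset.range (i + 1), c k * e (i - k)
      = ∑ m ∈ Finset.range N, ∑ k ∈ Finset.range (m + 1), c k * a (k + (m - k)) * e (m - k) := by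
    apply Finset.sum_congr rfl
    intro i _
    rw [Finset.mul_sum]
    apply Finset.sum_congr rfl
    intro k hk
    rw [show k + (i - k) = i by simp at hk; omega]; ring
  rw [h1, h]
  simp only [Finset.sum_mul]
  rw [Finset.sum_comm]
  apply Finset.sum_congr rfl
  intro j _
  symm
  have : ∀ k, c j * a (k + j) * e k = c j * a (j + k) * e k := by intro k; rw [add_comm]
  simp only [this]
  apply Finset.sum_subset
  · intro k; simp; omega
  · intro k _ hk
    rw [ha (j + k) (by simp at hk; omega)]; simp

theorem expand_mem_span {f : ℝ → ℝ} (hne : ∀ x, f x ≠ 0) (N : ℕ) (a b : ℕ → ℝ)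
    (ha : ∀ i, N ≤ i → a i = 0) (hb : ∀ i, N ≤ i → b i = 0) :
    ∃ A : ℕ → ℝ, ∀ x t,
      ∑ k ∈ Finset.range N,
        ((∑ j ∈ Finset.range N, t ^ j / j.factorial * a (k + j)) * (Sop f)^[k] f x
        + (∑ j ∈ Finset.range N, t ^ j / j.factorial * b (k + j)) * (Sop f)^[k] (phiOne f) x)
      = ∑ n ∈ Finset.range (2 * N + 1), A n * transmutedHeatPolyR f n x t := by
  refine ⟨fun n => (if Even n then a (n / 2) else b (n / 2)) / n.factorial, fun x t => ?_⟩
  rw [Finset.sum_add_distrib, sum_flip N a (fun j => t ^ j / j.factorial)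
      (fun k => (Sop f)^[k] f x) ha, sum_flip N b (fun j => t ^ j / j.factorial)
      (fun k => (Sop f)^[k] (phiOne f) x) hb, ← Finset.sum_add_distrib, Finset.sum_range_succ]
  simp only [even_two, Even.mul_right, if_true]
  rw [show 2 * N / 2 = N by omega, ha N le_rfl]
  simp only [zero_div, zero_mul, add_zero]
  clear ha hb
  induction N with
  | zero => simp
  | succ N ih =>
    rw [Finset.sum_range_succ _ N, show 2 * (N + 1) = 2 * N + 1 + 1 by ring,
      Finset.sum_range_succ _ (2 * N + 1), Finset.sum_range_succ _ (2 * N), ih, heatPoly_even hne, heatPoly_odd]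
    have h1 : ((2 * N).factorial : ℝ) ≠ 0 := by positivity
    have h2 : ((2 * N + 1).factorial : ℝ) ≠ 0 := by positivity
    rw [if_pos (by simp), if_neg (by simp), show 2 * N / 2 = N by omega,
      show (2 * N + 1) / 2 = N by omega]
    field_simp
    ring


/-! ### A compactly supported bump function of Gevrey class -/

theorem re_inv_ge {x : ℝ} (hx : 0 < x) {z : ℂ} (hz : ‖z - x‖ ≤ x / 2) :
    2 / (9 * x) ≤ (1 / z).re := by
  have h1 : |(z - x).re| ≤ x / 2 := (Complex.abs_re_le_norm _).trans hz
  have h2 : (z - x).re = z.re - x := by simp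
  rw [h2] at h1
  have h3 := abs_le.1 h1
  have h4 : ‖z‖ ≤ 3 * x / 2 := by
    have := norm_add_le (z - x) (x : ℂ)
    simp only [sub_add_cancel, Complex.norm_real, Real.norm_eq_abs, abs_of_pos hx] at this
    linarith
  have hre : x / 2 ≤ z.re := by linarith [h3.1]
  have hpos : 0 < ‖z‖ := by
    have := Complex.abs_re_le_norm z
    have := le_abs_self z.re
    linarith
  rw [one_div, Complex.inv_re, Complex.normSq_eq_norm_sq]
  rw [div_le_div_iff₀ (by positivity) (by positivity)]
  have : ‖z‖ ^ 2 ≤ (3 * x / 2) ^ 2 := pow_le_pow_left₀ hpos.le h4 2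
  nlinarith

/-- The complex bump profile. -/
noncomputable def bumpC (A δ : ℝ) (z : ℂ) : ℂ := Complex.exp (-((A : ℂ) / z) - (A : ℂ) / ((δ : ℂ) - z))

theorem bumpC_diffAt (A δ : ℝ) {z : ℂ} (h0 : z ≠ 0) (h1 : (δ : ℂ) - z ≠ 0) :
    DifferentiableAt ℂ (bumpC A δ) z := by
  unfold bumpC
  fun_prop (disch := assumption)

theorem re_pos_of_near {x d : ℝ} {z : ℂ} (hd : 0 < d) (hx : d ≤ x) (hz : ‖z - x‖ ≤ d / 2) :
    0 < z.re := by
  have h1 : |(z - x).re| ≤ d / 2 := (Complex.abs_re_le_norm _).trans hz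
  have h2 : (z - x).re = z.re - x := by simp
  rw [h2] at h1
  have h3 := abs_le.1 h1
  linarith [h3.1]

theorem bumpC_norm_le {A δ x d : ℝ} (hA : 0 < A) (hd : 0 < d) (hd1 : d ≤ x) (hd2 : d ≤ δ - x)
    (hd3 : d = x ∨ d = δ - x) {z : ℂ} (hz : ‖z - x‖ ≤ d / 2) :
    ‖bumpC A δ z‖ ≤ Real.exp (-(2 * A / (9 * d))) := by
  have hz' : ‖((δ : ℂ) - z) - ((δ - x : ℝ) : ℂ)‖ ≤ d / 2 := by
    rw [show ((δ : ℂ) - z) - ((δ - x : ℝ) : ℂ) = -(z - x) by push_cast; ring, norm_neg]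
    exact hz
  have p1 := re_pos_of_near hd hd1 hz
  have p2 := re_pos_of_near hd hd2 hz'
  have q1 : 0 ≤ (1 / z).re := by
    rw [one_div, Complex.inv_re]; exact div_nonneg p1.le (Complex.normSq_nonneg _)
  have q2 : 0 ≤ (1 / ((δ : ℂ) - z)).re := by
    rw [one_div, Complex.inv_re]; exact div_nonneg p2.le (Complex.normSq_nonneg _)
  unfold bumpC
  rw [Complex.norm_exp]
  apply Real.exp_le_exp.2
  have e : (-((A : ℂ) / z) - (A : ℂ) / ((δ : ℂ) - z)).re
      = - (A * (1 / z).re) - A * (1 / ((δ : ℂ) - z)).re := by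
    rw [div_eq_mul_one_div (A : ℂ) z, div_eq_mul_one_div (A : ℂ) ((δ : ℂ) - z)]
    simp only [Complex.sub_re, Complex.neg_re, Complex.re_ofReal_mul]
  rw [e]
  rcases hd3 with h | h
  · have := re_inv_ge (by linarith : 0 < x) (z := z) (hz.trans_eq (by rw [h]))
    rw [← h] at this
    have h5 := mul_le_mul_of_nonneg_left this hA.le
    have h6 := mul_nonneg hA.le q2
    have : A * (2 / (9 * d)) = 2 * A / (9 * d) := by ring
    linarith
  · have := re_inv_ge (by linarith : 0 < δ - x) (z := (δ : ℂ) - z) (hz'.trans_eq (by rw [h]))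
    rw [← h] at this
    have h5 := mul_le_mul_of_nonneg_left this hA.le
    have h6 := mul_nonneg hA.le q1
    have : A * (2 / (9 * d)) = 2 * A / (9 * d) := by ring
    linarith

theorem bumpC_iter_le {A δ x d : ℝ} (hA : 0 < A) (hd : 0 < d) (hd1 : d ≤ x) (hd2 : d ≤ δ - x)
    (hd3 : d = x ∨ d = δ - x) (k : ℕ) :
    ‖iteratedDeriv k (bumpC A δ) (x : ℂ)‖ ≤
      k.factorial * ((2 / d) ^ k * Real.exp (-(2 * A / (9 * d)))) := by
  have h := Complex.norm_iteratedDeriv_le_of_forall_mem_sphere_norm_le (c := (x : ℂ)) (R := d / 2)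
    (C := Real.exp (-(2 * A / (9 * d)))) (f := bumpC A δ) k (by positivity) ?_ ?_
  · refine h.trans (le_of_eq ?_)
    rw [div_pow, div_pow]
    field_simp
  · apply DifferentiableOn.diffContOnCl
    rw [closure_ball _ (by positivity)]
    intro z hz
    rw [Metric.mem_closedBall, dist_eq_norm] at hz
    apply DifferentiableAt.differentiableWithinAt
    apply bumpC_diffAt
    · intro h0
      have := re_pos_of_near hd hd1 hz
      simp [h0] at this
    · intro h0
      have hz' : ‖((δ : ℂ) - z) - ((δ - x : ℝ) : ℂ)‖ ≤ d / 2 := by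
        rw [show ((δ : ℂ) - z) - ((δ - x : ℝ) : ℂ) = -(z - x) by push_cast; ring, norm_neg]
        exact hz
      have := re_pos_of_near hd hd2 hz'
      rw [h0] at this
      simp at this
  · intro z hz
    rw [mem_sphere_iff_norm] at hz
    exact bumpC_norm_le hA hd hd1 hd2 hd3 hz.le

theorem pow_mul_exp_neg_le {y : ℝ} (hy : 0 ≤ y) (n : ℕ) :
    y ^ n * Real.exp (-y) ≤ n.factorial := by
  have h := Real.pow_div_factorial_le_exp y hy n
  rw [div_le_iff₀ (by positivity)] at h
  calc y ^ n * Real.exp (-y) ≤ (Real.exp y * n.factorial) * Real.exp (-y) := by gcongr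
    _ = n.factorial * (Real.exp y * Real.exp (-y)) := by ring
    _ = _ := by rw [← Real.exp_add]; simp

theorem bumpC_iter_le1 {A δ x d : ℝ} (hA : 0 < A) (hd : 0 < d) (hd1 : d ≤ x) (hd2 : d ≤ δ - x)
    (hd3 : d = x ∨ d = δ - x) (k : ℕ) :
    ‖iteratedDeriv k (bumpC A δ) (x : ℂ)‖ ≤ (k.factorial : ℝ) ^ 2 * (9 / A) ^ k := by
  refine (bumpC_iter_le hA hd hd1 hd2 hd3 k).trans ?_
  have h := pow_mul_exp_neg_le (y := 2 * A / (9 * d)) (by positivity) k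
  have e : (2 / d) ^ k = (9 / A) ^ k * (2 * A / (9 * d)) ^ k := by
    rw [← mul_pow]; congr 1; field_simp
  rw [e]
  calc _ = (k.factorial : ℝ) * (9 / A) ^ k * ((2 * A / (9 * d)) ^ k
        * Real.exp (-(2 * A / (9 * d)))) := by ring
    _ ≤ (k.factorial : ℝ) * (9 / A) ^ k * k.factorial := by gcongr
    _ = _ := by ring

theorem bumpC_iter_le2 {A δ : ℝ} (hA : 0 < A) (k : ℕ) : ∃ C : ℝ, 0 ≤ C ∧ ∀ x d : ℝ, 0 < d →
    d ≤ x → d ≤ δ - x → (d = x ∨ d = δ - x) →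
    ‖iteratedDeriv k (bumpC A δ) (x : ℂ)‖ ≤ C * d ^ 2 := by
  refine ⟨(k.factorial : ℝ) * (9 / A) ^ k * (9 / (2 * A)) ^ 2 * (k + 2).factorial, by positivity, ?_⟩
  intro x d hd hd1 hd2 hd3
  refine (bumpC_iter_le hA hd hd1 hd2 hd3 k).trans ?_
  have h := pow_mul_exp_neg_le (y := 2 * A / (9 * d)) (by positivity) (k + 2)
  have e : (2 / d) ^ k = (9 / A) ^ k * (2 * A / (9 * d)) ^ (k + 2) * ((9 / (2 * A)) ^ 2 * d ^ 2) := by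
    have : (2 / d) ^ k = (9 / A) ^ k * (2 * A / (9 * d)) ^ k := by
      rw [← mul_pow]; congr 1; field_simp
    rw [this, pow_add]
    have : (2 * A / (9 * d)) ^ 2 * ((9 / (2 * A)) ^ 2 * d ^ 2) = 1 := by field_simp
    linear_combination (-((9 / A) ^ k * (2 * A / (9 * d)) ^ k)) * this
  rw [e]
  calc _ = (k.factorial : ℝ) * (9 / A) ^ k * (9 / (2 * A)) ^ 2 * d ^ 2 * ((2 * A / (9 * d)) ^ (k + 2)
        * Real.exp (-(2 * A / (9 * d)))) := by ring
    _ ≤ (k.factorial : ℝ) * (9 / A) ^ k * (9 / (2 * A)) ^ 2 * d ^ 2 * (k + 2).factorial := by gcongr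
    _ = _ := by ring

open Classical in
/-- The real bump function and its derivatives. -/
noncomputable def bumpR (A δ : ℝ) (k : ℕ) (x : ℝ) : ℝ :=
  if 0 < x ∧ x < δ then (iteratedDeriv k (bumpC A δ) (x : ℂ)).re else 0

theorem exists_d {δ x : ℝ} (h : 0 < x ∧ x < δ) : ∃ d, 0 < d ∧ d ≤ x ∧ d ≤ δ - x ∧
    (d = x ∨ d = δ - x) := by
  rcases le_total x (δ - x) with h1 | h1
  · exact ⟨x, h.1, le_rfl, h1, Or.inl rfl⟩
  · exact ⟨δ - x, by linarith [h.2], h1, le_rfl, Or.inr rfl⟩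

theorem bumpR_bound {A : ℝ} (δ : ℝ) (hA : 0 < A) (k : ℕ) (x : ℝ) :
    |bumpR A δ k x| ≤ (k.factorial : ℝ) ^ 2 * (9 / A) ^ k := by
  unfold bumpR
  split_ifs with h
  · obtain ⟨d, hd, hd1, hd2, hd3⟩ := exists_d h
    exact (Complex.abs_re_le_norm _).trans (bumpC_iter_le1 hA hd hd1 hd2 hd3 k)
  · simp; positivity

theorem bumpR_hasDerivAt {A δ : ℝ} (hA : 0 < A) (k : ℕ) (x : ℝ) :
    HasDerivAt (bumpR A δ k) (bumpR A δ (k + 1) x) x := by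
  by_cases h : 0 < x ∧ x < δ
  · have e : bumpR A δ k =ᶠ[nhds x] fun y => (iteratedDeriv k (bumpC A δ) (y : ℂ)).re := by
      filter_upwards [Ioo_mem_nhds h.1 h.2] with y hy
      simp only [bumpR]; exact if_pos hy
    have e2 : bumpR A δ (k + 1) x = (iteratedDeriv (k + 1) (bumpC A δ) (x : ℂ)).re := by
      simp only [bumpR]; rw [if_pos h]
    rw [e2]
    refine HasDerivAt.congr_of_eventuallyEq ?_ e
    apply HasDerivAt.real_of_complex
    rw [iteratedDeriv_succ]
    apply DifferentiableAt.hasDerivAt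
    have hopen : IsOpen {z : ℂ | z ≠ 0 ∧ (δ : ℂ) - z ≠ 0} :=
      (isOpen_ne_fun continuous_id continuous_const).inter
        (isOpen_ne_fun (by fun_prop) continuous_const)
    have han : AnalyticOnNhd ℂ (bumpC A δ) {z : ℂ | z ≠ 0 ∧ (δ : ℂ) - z ≠ 0} := by
      apply DifferentiableOn.analyticOnNhd _ hopen
      intro z hz
      exact (bumpC_diffAt A δ hz.1 hz.2).differentiableWithinAt
    have hx : (x : ℂ) ∈ {z : ℂ | z ≠ 0 ∧ (δ : ℂ) - z ≠ 0} := by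
      refine ⟨by exact_mod_cast h.1.ne', ?_⟩
      have : δ - x ≠ 0 := by linarith [h.2]
      exact_mod_cast this
    rw [iteratedDeriv_eq_iterate]
    exact ((han.iterated_deriv k) _ hx).differentiableAt
  · have e2 : bumpR A δ (k + 1) x = 0 := by simp only [bumpR]; rw [if_neg h]
    have e3 : bumpR A δ k x = 0 := by simp only [bumpR]; rw [if_neg h]
    rw [e2]
    obtain ⟨C, hC0, hC⟩ := bumpC_iter_le2 (δ := δ) hA k
    have hb : ∀ y, |bumpR A δ k y| ≤ C * (y - x) ^ 2 := by
      intro y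
      unfold bumpR
      split_ifs with hy
      · obtain ⟨d, hd, hd1, hd2, hd3⟩ := exists_d hy
        refine (Complex.abs_re_le_norm _).trans ((hC y d hd hd1 hd2 hd3).trans ?_)
        apply mul_le_mul_of_nonneg_left _ hC0
        by_cases hx : 0 < x
        · have : δ ≤ x := by by_contra hh; exact h ⟨hx, by linarith⟩
          nlinarith
        · nlinarith
      · simp; positivity
    rw [hasDerivAt_iff_isLittleO, e3]
    simp only [sub_zero, smul_zero]
    have h1 : (fun y => bumpR A δ k y) =O[nhds x] fun y => (y - x) ^ 2 := by
      apply Asymptotics.IsBigO.of_bound C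
      filter_upwards with y
      simpa using hb y
    refine h1.trans_isLittleO ?_
    simpa using (Asymptotics.isLittleO_pow_sub_sub x (one_lt_two))

theorem exists_bump (A δ : ℝ) (hA : 0 < A) (hδ : 0 < δ) :
    ∃ (ρ : ℕ → ℝ → ℝ) (C : ℝ), 0 < C ∧ (∀ k x, HasDerivAt (ρ k) (ρ (k + 1) x) x) ∧
      (∀ k x, x ∉ Set.Ioo 0 δ → ρ k x = 0) ∧ (∀ x, 0 ≤ ρ 0 x) ∧
      (∫ x in (0:ℝ)..δ, ρ 0 x) = 1 ∧
      ∀ k x, |ρ k x| ≤ C * ((k.factorial : ℝ) ^ 2 * (9 / A) ^ k) := by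
  have hpos : ∀ x ∈ Set.Ioo 0 δ, 0 < bumpR A δ 0 x := by
    intro x hx
    simp only [bumpR]
    rw [if_pos (show 0 < x ∧ x < δ from hx), iteratedDeriv_zero, bumpC]
    have : (-((A : ℂ) / x) - (A : ℂ) / ((δ : ℂ) - x)) = ((-(A / x) - A / (δ - x) : ℝ) : ℂ) := by
      push_cast; ring
    rw [this, ← Complex.ofReal_exp, Complex.ofReal_re]
    positivity
  have hcont : Continuous (bumpR A δ 0) :=
    continuous_iff_continuousAt.2 fun x => (bumpR_hasDerivAt hA 0 x).continuousAt
  set I := ∫ x in (0:ℝ)..δ, bumpR A δ 0 x with hI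
  have hIpos : 0 < I :=
    intervalIntegral.intervalIntegral_pos_of_pos_on (hcont.intervalIntegrable _ _) hpos hδ
  have hz : ∀ k x, x ∉ Set.Ioo 0 δ → bumpR A δ k x = 0 := by
    intro k x hx
    exact if_neg hx
  refine ⟨fun k x => I⁻¹ * bumpR A δ k x, I⁻¹, by positivity, ?_, ?_, ?_, ?_, ?_⟩
  · intro k x; exact (bumpR_hasDerivAt hA k x).const_mul _
  · intro k x hx; simp only [hz k x hx, mul_zero]
  · intro x
    by_cases hx : x ∈ Set.Ioo 0 δ
    · exact (mul_pos (inv_pos.2 hIpos) (hpos x hx)).le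
    · simp only [hz 0 x hx, mul_zero, le_refl]
  · rw [intervalIntegral.integral_const_mul]; exact inv_mul_cancel₀ hIpos.ne'
  · intro k x
    rw [abs_mul, abs_of_pos (inv_pos.2 hIpos)]
    exact mul_le_mul_of_nonneg_left (bumpR_bound δ hA k x) (inv_pos.2 hIpos).le


/-! ### Polynomial approximation of the kernel (Landau kernels) -/

theorem landau (R ε : ℝ) (hR : 0 < R) (hε : 0 < ε) :
    ∃ l : Polynomial ℝ, (∀ y ∈ Set.Icc (-R) R, 0 ≤ l.eval y) ∧
      (∫ y in (-R)..R, l.eval y) = 1 ∧ (∫ y in (-R)..R, |y| * l.eval y) ≤ ε := by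
  have hlt : -R < R := by linarith
  set c : ℝ → ℝ := fun y => 1 - (y / R) ^ 2 with hc
  have hcc : Continuous c := by fun_prop
  have hle : ∀ y ∈ Set.Icc (-R) R, 0 ≤ c y := by
    intro y hy
    have : |y / R| ≤ 1 := by
      rw [abs_div, abs_of_pos hR, div_le_one hR]; exact abs_le.2 hy
    have := (sq_le_one_iff_abs_le_one (y / R)).2 this
    simp only [hc]; linarith
  have ht := tendsto_setIntegral_pow_smul_of_unique_maximum_of_isCompact_of_continuousOn
    (μ := MeasureTheory.volume) (s := Set.Icc (-R) R) (x₀ := (0:ℝ)) (c := c)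
    (g := fun y : ℝ => |y|) isCompact_Icc hcc.continuousOn
    (by
      intro y _ hy
      simp only [hc]
      have : 0 < (y / R) ^ 2 := by positivity
      simp; positivity)
    hle (by simp [hc])
    (by rw [interior_Icc, closure_Ioo hlt.ne]; constructor <;> linarith)
    continuous_abs.continuousOn
  simp only [abs_zero] at ht
  obtain ⟨n, hn⟩ := ((ht.eventually (gt_mem_nhds hε))).exists
  have hI : 0 < ∫ y in (-R)..R, c y ^ n := by
    apply intervalIntegral.intervalIntegral_pos_of_pos_on ((hcc.pow n).intervalIntegrable _ _) _ hlt
    intro y hy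
    apply pow_pos
    have : |y / R| < 1 := by
      rw [abs_div, abs_of_pos hR, div_lt_one hR]; exact abs_lt.2 hy
    have := (sq_lt_one_iff_abs_lt_one (y / R)).2 this
    simp only [hc]; linarith
  set I := ∫ y in (-R)..R, c y ^ n with hIdef
  rw [MeasureTheory.integral_Icc_eq_integral_Ioc, MeasureTheory.integral_Icc_eq_integral_Ioc,
    ← intervalIntegral.integral_of_le hlt.le, ← intervalIntegral.integral_of_le hlt.le] at hn
  simp only [smul_eq_mul] at hn
  let l : Polynomial ℝ := Polynomial.C I⁻¹ * (1 - (Polynomial.C R⁻¹ * Polynomial.X) ^ 2) ^ n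
  have hl : ∀ y, l.eval y = I⁻¹ * c y ^ n := by
    intro y
    simp [l, hc, div_eq_inv_mul]
  refine ⟨l, ?_, ?_, ?_⟩
  · intro y hy
    rw [hl]; exact mul_nonneg (inv_pos.2 hI).le (pow_nonneg (hle y hy) _)
  · simp only [hl, intervalIntegral.integral_const_mul]
    exact inv_mul_cancel₀ hI.ne'
  · have : ∀ y, |y| * l.eval y = I⁻¹ * (c y ^ n * |y|) := by intro y; rw [hl]; ring
    simp only [this, intervalIntegral.integral_const_mul]
    exact hn.le

theorem poly_taylor (l : Polynomial ℝ) (N : ℕ) (hN : l.natDegree < N) (t r : ℝ) :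
    l.eval (t + r) = ∑ j ∈ Finset.range N,
      t ^ j / j.factorial * (Polynomial.derivative^[j] l).eval r := by
  rw [← Polynomial.taylor_eval, Polynomial.eval_eq_sum_range' (n := N)]
  · apply Finset.sum_congr rfl
    intro j _
    rw [Polynomial.taylor_coeff]
    have : (j.factorial : ℝ) * (Polynomial.hasseDeriv j l).eval r
        = (Polynomial.derivative^[j] l).eval r := by
      have h := congrArg (fun F => Polynomial.eval r (F l)) (Polynomial.factorial_smul_hasseDeriv (R := ℝ) j)
      simpa using h
    rw [← this]
    have : (j.factorial : ℝ) ≠ 0 := by positivity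
    field_simp
  · rwa [Polynomial.natDegree_taylor]

theorem approx_kernel (ρ : ℕ → ℝ → ℝ) (M : ℕ → ℝ) (δ T ε : ℝ) (hδ : 0 < δ) (hT : 0 < T) (hε : 0 < ε)
    (hd : ∀ k x, HasDerivAt (ρ k) (ρ (k + 1) x) x)
    (h0 : ∀ k x, x ∉ Set.Ioo 0 δ → ρ k x = 0) (hM : ∀ k x, |ρ k x| ≤ M k) :
    ∃ (κ : ℕ → ℝ → ℝ) (N : ℕ), (∀ k, Continuous (κ k)) ∧ (∀ k, N ≤ k → ∀ z, κ k z = 0) ∧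
      (∀ k t τ, κ k (t - τ) = ∑ j ∈ Finset.range N, t ^ j / j.factorial * κ (k + j) (-τ)) ∧
      ∀ k, ∀ z ∈ Set.Icc (-T) T, |κ k z - ρ k z| ≤ ε * M (k + 1) := by
  obtain ⟨l, hl0, hl1, hl2⟩ := landau (T + δ) ε (by linarith) hε
  have hρc : ∀ k, Continuous (ρ k) := fun k =>
    continuous_iff_continuousAt.2 fun x => (hd k x).continuousAt
  have hparts : ∀ i j z, ∫ y in (0:ℝ)..δ, ρ i y * (Polynomial.derivative^[j + 1] l).eval (z - y)
      = ∫ y in (0:ℝ)..δ, ρ (i + 1) y * (Polynomial.derivative^[j] l).eval (z - y) := by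
    intro i j z
    have hv : ∀ y, HasDerivAt (fun y => (Polynomial.derivative^[j] l).eval (z - y))
        (-(Polynomial.derivative^[j + 1] l).eval (z - y)) y := by
      intro y
      have h1 := ((Polynomial.derivative^[j] l).hasDerivAt (z - y)).comp y
        ((hasDerivAt_id y).const_sub z)
      rw [Function.iterate_succ_apply']
      exact h1.congr_deriv (by simp)
    have h := intervalIntegral.integral_mul_deriv_eq_deriv_mul (a := 0) (b := δ)
      (fun y _ => hd i y) (fun y _ => hv y) ((hρc _).intervalIntegrable _ _)
      ((by fun_prop : Continuous fun y => -(Polynomial.derivative^[j + 1] l).eval (z - y)).intervalIntegrable _ _)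
    rw [h0 i δ (by simp), h0 i 0 (by simp)] at h
    simp only [mul_neg, intervalIntegral.integral_neg] at h
    linarith
  have hparts' : ∀ k i z, ∫ y in (0:ℝ)..δ, ρ i y * (Polynomial.derivative^[k] l).eval (z - y)
      = ∫ y in (0:ℝ)..δ, ρ (i + k) y * l.eval (z - y) := by
    intro k
    induction k with
    | zero => intro i z; simp
    | succ k ih =>
      intro i z
      rw [hparts, ih, show i + 1 + k = i + (k + 1) by ring]
  refine ⟨fun k z => ∫ y in (0:ℝ)..δ, ρ 0 y * (Polynomial.derivative^[k] l).eval (z - y),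
    l.natDegree + 1, ?_, ?_, ?_, ?_⟩
  · intro k
    apply intervalIntegral.continuous_parametric_intervalIntegral_of_continuous'
    have := hρc 0
    simp only [Function.uncurry_def]
    fun_prop
  · intro k hk z
    simp only
    rw [Polynomial.iterate_derivative_eq_zero (by omega)]
    simp
  · intro k t τ
    simp only
    have : ∀ y, ρ 0 y * (Polynomial.derivative^[k] l).eval (t - τ - y)
        = ∑ j ∈ Finset.range (l.natDegree + 1), t ^ j / j.factorial *
          (ρ 0 y * (Polynomial.derivative^[k + j] l).eval (-τ - y)) := by
      intro y
      rw [show t - τ - y = t + (-τ - y) by ring, poly_taylor _ (l.natDegree + 1), Finset.mul_sum]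
      · apply Finset.sum_congr rfl
        intro j _
        rw [← Function.iterate_add_apply, add_comm j k]; ring
      · exact Nat.lt_succ_of_le ((Polynomial.natDegree_iterate_derivative _ _).trans (Nat.sub_le _ _))
    simp only [this]
    rw [intervalIntegral.integral_finsetSum]
    · apply Finset.sum_congr rfl
      intro j _
      rw [intervalIntegral.integral_const_mul]
    · intro j _
      have := hρc 0
      exact (by fun_prop : Continuous _).intervalIntegrable _ _
  · intro k z hz
    simp only
    rw [hparts', zero_add]
    have hρk := hρc k
    have e1 : ∫ y in (0:ℝ)..δ, ρ k y * l.eval (z - y)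
        = ∫ y in (-(T + δ))..(T + δ), ρ k (z - y) * l.eval y := by
      have h1 := intervalIntegral.integral_comp_sub_left (a := 0) (b := δ)
        (fun y => ρ k (z - y) * l.eval y) z
      simp only [sub_sub_cancel, sub_zero] at h1
      rw [h1]
      have hcont : Continuous fun y => ρ k (z - y) * l.eval y := by fun_prop
      rw [← intervalIntegral.integral_add_adjacent_intervals (a := -(T + δ)) (b := z - δ)
        (c := T + δ) (hcont.intervalIntegrable _ _) (hcont.intervalIntegrable _ _),
        ← intervalIntegral.integral_add_adjacent_intervals (a := z - δ) (b := z)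
        (c := T + δ) (hcont.intervalIntegrable _ _) (hcont.intervalIntegrable _ _)]
      have z1 : ∫ y in (-(T + δ))..(z - δ), ρ k (z - y) * l.eval y = 0 := by
        rw [intervalIntegral.integral_congr (g := fun _ => (0:ℝ))]
        · simp
        · intro y hy
          rw [Set.uIcc_of_le (by linarith [hz.1])] at hy
          simp only
          rw [h0 k (z - y) (by intro h; linarith [h.2, hy.2]), zero_mul]
      have z2 : ∫ y in z..(T + δ), ρ k (z - y) * l.eval y = 0 := by
        rw [intervalIntegral.integral_congr (g := fun _ => (0:ℝ))]
        · simp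
        · intro y hy
          rw [Set.uIcc_of_le (by linarith [hz.2])] at hy
          simp only
          rw [h0 k (z - y) (by intro h; linarith [h.1, hy.1]), zero_mul]
      rw [z1, z2]; ring
    have e2 : ρ k z = ∫ y in (-(T + δ))..(T + δ), ρ k z * l.eval y := by
      rw [intervalIntegral.integral_const_mul, hl1, mul_one]
    rw [e1]
    nth_rewrite 1 [e2]
    rw [← intervalIntegral.integral_sub ((by fun_prop : Continuous _).intervalIntegrable _ _)
      ((by fun_prop : Continuous _).intervalIntegrable _ _)]
    have hle : -(T + δ) ≤ T + δ := by linarith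
    have hlip : ∀ y, |ρ k (z - y) - ρ k z| ≤ M (k + 1) * |y| := by
      intro y
      have := Convex.norm_image_sub_le_of_norm_hasDerivWithin_le (f := ρ k) (f' := ρ (k + 1))
        (s := Set.univ) (C := M (k + 1)) (x := z) (y := z - y)
        (fun x _ => (hd k x).hasDerivWithinAt) (fun x _ => hM (k + 1) x) convex_univ
        (Set.mem_univ _) (Set.mem_univ _)
      simpa using this
    calc _ ≤ ∫ y in (-(T + δ))..(T + δ), |ρ k (z - y) * l.eval y - ρ k z * l.eval y| :=
          intervalIntegral.abs_integral_le_integral_abs hle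
      _ ≤ ∫ y in (-(T + δ))..(T + δ), M (k + 1) * (|y| * l.eval y) := by
          apply intervalIntegral.integral_mono_on hle
          · exact (by fun_prop : Continuous _).intervalIntegrable _ _
          · exact (by fun_prop : Continuous _).intervalIntegrable _ _
          · intro y hy
            rw [← sub_mul, abs_mul, abs_of_nonneg (hl0 y hy), ← mul_assoc]
            exact mul_le_mul_of_nonneg_right (hlip y) (hl0 y hy)
      _ = M (k + 1) * ∫ y in (-(T + δ))..(T + δ), |y| * l.eval y := by
          rw [intervalIntegral.integral_const_mul]
      _ ≤ M (k + 1) * ε := mul_le_mul_of_nonneg_left hl2 ((abs_nonneg _).trans (hM (k + 1) 0))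
      _ = _ := mul_comm _ _


/-! ### The mollified equation -/

theorem hasDerivAt_int {G Gx : ℝ × ℝ → ℝ} {κ : ℝ → ℝ} (hκ : Continuous κ) {b c d : ℝ} (hcd : c ≤ d)
    (hd : ∀ x ∈ Set.Ioo 0 b, ∀ τ ∈ Set.Icc c d, HasDerivAt (fun x => G (x, τ)) (Gx (x, τ)) x)
    (hG : ContinuousOn G (Set.Ioo 0 b ×ˢ Set.Icc c d))
    (hGx : ContinuousOn Gx (Set.Ioo 0 b ×ˢ Set.Icc c d)) :
    ∀ x ∈ Set.Ioo 0 b, HasDerivAt (fun x => ∫ τ in c..d, κ τ * G (x, τ))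
      (∫ τ in c..d, κ τ * Gx (x, τ)) x := by
  intro x hx
  obtain ⟨x1, hx1, hx1'⟩ := exists_between hx.1
  obtain ⟨x2, hx2, hx2'⟩ := exists_between hx.2
  have hslice : ∀ H : ℝ × ℝ → ℝ, ContinuousOn H (Set.Ioo 0 b ×ˢ Set.Icc c d) →
      ∀ y ∈ Set.Ioo 0 b, ContinuousOn (fun τ => κ τ * H (y, τ)) (Set.Icc c d) := by
    intro H hH y hy
    apply hκ.continuousOn.mul
    exact hH.comp (by fun_prop) (fun τ hτ => ⟨hy, hτ⟩)
  have hGxc : ContinuousOn (fun p : ℝ × ℝ => κ p.2 * Gx p) (Set.Icc x1 x2 ×ˢ Set.Icc c d) := by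
    apply ContinuousOn.mul (by fun_prop)
    apply hGx.mono
    rintro p ⟨hp1, hp2⟩
    exact ⟨⟨by linarith [hp1.1], by linarith [hp1.2]⟩, hp2⟩
  obtain ⟨C, hC⟩ := (isCompact_Icc.prod isCompact_Icc).exists_bound_of_continuousOn hGxc
  have hu : Set.uIoc c d ⊆ Set.Icc c d := by
    rw [Set.uIoc_of_le hcd]; exact Set.Ioc_subset_Icc_self
  refine (intervalIntegral.hasDerivAt_integral_of_dominated_loc_of_deriv_le
    (F := fun x τ => κ τ * G (x, τ)) (F' := fun x τ => κ τ * Gx (x, τ)) (s := Set.Icc x1 x2)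
    (bound := fun _ => C) (Icc_mem_nhds hx1' hx2) ?_ ?_ ?_ ?_ ?_ ?_).2
  · filter_upwards [Ioo_mem_nhds hx.1 hx.2] with y hy
    exact ((hslice G hG y hy).mono hu).aestronglyMeasurable measurableSet_uIoc
  · apply ContinuousOn.intervalIntegrable
    rw [Set.uIcc_of_le hcd]
    exact hslice G hG x hx
  · exact ((hslice Gx hGx x hx).mono hu).aestronglyMeasurable measurableSet_uIoc
  · filter_upwards with τ hτ y hy
    exact hC (y, τ) ⟨hy, hu hτ⟩
  · exact intervalIntegrable_const
  · filter_upwards with τ hτ y hy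
    exact (hd y ⟨by linarith [hy.1], by linarith [hy.2]⟩ τ (hu hτ)).const_mul _

theorem key_identity {f f' q : ℝ → ℝ} (hf : Continuous f) (hne : ∀ x, f x ≠ 0) (hf0 : f 0 = 1)
    {b c d : ℝ} (hb : 0 < b) (hcd : c ≤ d)
    (hfd : ∀ x ∈ Set.Ioo 0 b, HasDerivAt f (f' x) x)
    (hfd' : ∀ x ∈ Set.Ioo 0 b, HasDerivAt f' (q x * f x) x)
    {u ux uxx ut : ℝ × ℝ → ℝ} (hu : Continuous u)
    (hux : ∀ x ∈ Set.Ioo 0 b, ∀ τ ∈ Set.Icc c d, HasDerivAt (fun x => u (x, τ)) (ux (x, τ)) x)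
    (huxx : ∀ x ∈ Set.Ioo 0 b, ∀ τ ∈ Set.Icc c d, HasDerivAt (fun x => ux (x, τ)) (uxx (x, τ)) x)
    (hut : ∀ x ∈ Set.Ioo 0 b, ∀ τ ∈ Set.Icc c d, HasDerivAt (fun t => u (x, t)) (ut (x, τ)) τ)
    (cux : ContinuousOn ux (Set.Ioo 0 b ×ˢ Set.Icc c d))
    (cuxx : ContinuousOn uxx (Set.Ioo 0 b ×ˢ Set.Icc c d))
    (cut : ContinuousOn ut (Set.Ioo 0 b ×ˢ Set.Icc c d))
    (heq : ∀ x ∈ Set.Ioo 0 b, ∀ τ ∈ Set.Icc c d, uxx (x, τ) - q x * u (x, τ) = ut (x, τ))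
    {κ κ' : ℝ → ℝ} (hκ : ∀ τ, HasDerivAt κ (κ' τ) τ) (hκ' : Continuous κ') (hκc : κ c = 0)
    (hκd : κ d = 0) :
    ∃ β : ℝ, ∀ x ∈ Set.Icc 0 b, (∫ τ in c..d, κ τ * u (x, τ)) =
      (∫ τ in c..d, κ τ * u (0, τ)) * f x + β * phiOne f x
        + Sop f (fun x => - ∫ τ in c..d, κ' τ * u (x, τ)) x := by
  have cκ : Continuous κ := continuous_iff_continuousAt.2 fun x => (hκ x).continuousAt
  set w : ℝ → ℝ := fun x => ∫ τ in c..d, κ τ * u (x, τ) with hw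
  set wx : ℝ → ℝ := fun x => ∫ τ in c..d, κ τ * ux (x, τ) with hwx
  set w1 : ℝ → ℝ := fun x => - ∫ τ in c..d, κ' τ * u (x, τ) with hw1
  have cw : Continuous w := by
    apply intervalIntegral.continuous_parametric_intervalIntegral_of_continuous'
    simp only [Function.uncurry_def]
    fun_prop
  have cw1 : Continuous w1 := by
    apply Continuous.neg
    apply intervalIntegral.continuous_parametric_intervalIntegral_of_continuous'
    simp only [Function.uncurry_def]
    fun_prop
  have d1 : ∀ x ∈ Set.Ioo 0 b, HasDerivAt w (wx x) x :=
    hasDerivAt_int cκ hcd hux hu.continuousOn cux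
  have d2 : ∀ x ∈ Set.Ioo 0 b, HasDerivAt wx (q x * w x + w1 x) x := by
    intro x hx
    have h := hasDerivAt_int cκ hcd huxx cux cuxx x hx
    have e : ∫ τ in c..d, κ τ * uxx (x, τ) = q x * w x + w1 x := by
      have i1 : ContinuousOn (fun τ => κ τ * ut (x, τ)) (Set.uIcc c d) := by
        rw [Set.uIcc_of_le hcd]
        exact cκ.continuousOn.mul (cut.comp (by fun_prop) (fun τ hτ => ⟨hx, hτ⟩))
      have i2 : ContinuousOn (fun τ => ut (x, τ)) (Set.uIcc c d) := by
        rw [Set.uIcc_of_le hcd]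
        exact (cut.comp (by fun_prop) (fun τ hτ => ⟨hx, hτ⟩))
      have e1 : ∫ τ in c..d, κ τ * uxx (x, τ)
          = ∫ τ in c..d, (q x * (κ τ * u (x, τ)) + κ τ * ut (x, τ)) := by
        apply intervalIntegral.integral_congr
        intro τ hτ
        rw [Set.uIcc_of_le hcd] at hτ
        simp only
        rw [← heq x hx τ hτ]; ring
      rw [e1, intervalIntegral.integral_add _ i1.intervalIntegrable,
        intervalIntegral.integral_const_mul]
      · congr 1
        have := intervalIntegral.integral_mul_deriv_eq_deriv_mul (a := c) (b := d)
          (u := κ) (u' := κ') (v := fun τ => u (x, τ)) (v' := fun τ => ut (x, τ))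
          (fun τ _ => hκ τ) (fun τ hτ => hut x hx τ (by rwa [Set.uIcc_of_le hcd] at hτ))
          (hκ'.intervalIntegrable _ _) i2.intervalIntegrable
        rw [this, hκc, hκd, hw1]; simp
      · exact (by fun_prop : Continuous _).intervalIntegrable _ _
    rw [← e]; exact h
  have cf2 : Continuous (fun y => (f y ^ 2)⁻¹) :=
    (hf.pow 2).inv₀ (fun x => pow_ne_zero _ (hne x))
  have cP : Continuous (fun y => ∫ z in (0:ℝ)..y, f z * w1 z) := continuous_prim (hf.mul cw1)
  have dP : ∀ y, HasDerivAt (fun y => ∫ z in (0:ℝ)..y, f z * w1 z) (f y * w1 y) y := fun y =>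
    intervalIntegral.integral_hasDerivAt_right ((hf.mul cw1).intervalIntegrable _ _)
      ((hf.mul cw1).stronglyMeasurableAtFilter _ _) (hf.mul cw1).continuousAt
  set Z : ℝ → ℝ := fun x => f x * wx x - f' x * w x - ∫ z in (0:ℝ)..x, f z * w1 z with hZ
  have dZ : ∀ x ∈ Set.Ioo 0 b, HasDerivAt Z 0 x := by
    intro x hx
    have := (((hfd x hx).mul (d2 x hx)).sub ((hfd' x hx).mul (d1 x hx))).sub (dP x)
    refine HasDerivAt.congr_deriv this ?_
    ring
  have hZc : ∀ x ∈ Set.Ioo 0 b, ∀ y ∈ Set.Ioo 0 b, x < y → Z x = Z y := by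
    intro x hx y hy hxy
    have hsub : ∀ z ∈ Set.Icc x y, z ∈ Set.Ioo 0 b := fun z hz =>
      ⟨lt_of_lt_of_le hx.1 hz.1, lt_of_le_of_lt hz.2 hy.2⟩
    obtain ⟨z, hz, hz'⟩ := exists_hasDerivAt_eq_slope Z (fun _ => 0) hxy
      (fun z hz => (dZ z (hsub z hz)).continuousAt.continuousWithinAt)
      (fun z hz => dZ z (hsub z (Set.Ioo_subset_Icc_self hz)))
    have hne' : y - x ≠ 0 := by linarith
    field_simp at hz'
    linarith
  have hb2 : b / 2 ∈ Set.Ioo 0 b := ⟨by linarith, by linarith⟩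
  have hZ2 : ∀ x ∈ Set.Ioo 0 b, Z x = Z (b / 2) := by
    intro x hx
    rcases lt_trichotomy x (b / 2) with h | h | h
    · exact hZc x hx _ hb2 h
    · rw [h]
    · exact (hZc _ hb2 x hx h).symm
  set β := Z (b / 2) with hβ
  refine ⟨β, ?_⟩
  have cI : Continuous (fun y => (f y ^ 2)⁻¹ * (β + ∫ z in (0:ℝ)..y, f z * w1 z)) :=
    cf2.mul (continuous_const.add cP)
  set Y : ℝ → ℝ := fun x => w x / f x
    - ∫ y in (0:ℝ)..x, (f y ^ 2)⁻¹ * (β + ∫ z in (0:ℝ)..y, f z * w1 z) with hY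
  have cY : Continuous Y := (cw.div hf hne).sub (continuous_prim cI)
  have dY : ∀ x ∈ Set.Ioo 0 b, HasDerivAt Y 0 x := by
    intro x hx
    have dI : HasDerivAt (fun x => ∫ y in (0:ℝ)..x, (f y ^ 2)⁻¹ * (β + ∫ z in (0:ℝ)..y, f z * w1 z))
        ((f x ^ 2)⁻¹ * (β + ∫ z in (0:ℝ)..x, f z * w1 z)) x :=
      intervalIntegral.integral_hasDerivAt_right (cI.intervalIntegrable _ _)
        (cI.stronglyMeasurableAtFilter _ _) cI.continuousAt
    have := ((d1 x hx).div (hfd x hx) (hne x)).sub dI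
    refine HasDerivAt.congr_deriv this ?_
    have hz : β = f x * wx x - f' x * w x - ∫ z in (0:ℝ)..x, f z * w1 z := (hZ2 x hx).symm
    have := hne x
    rw [hz]
    field_simp
    ring
  intro x hx
  have hYx : Y x = w 0 := by
    have hY0 : Y 0 = w 0 := by simp [hY, hf0]
    rcases hx.1.eq_or_lt with h | h
    · rw [← h, hY0]
    · obtain ⟨z, hz, hz'⟩ := exists_hasDerivAt_eq_slope Y (fun _ => 0) h cY.continuousOn
        (fun z hz => dY z ⟨hz.1, lt_of_lt_of_le hz.2 hx.2⟩)
      have : x - 0 ≠ 0 := by linarith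
      field_simp at hz'
      linarith
  have e2 : ∫ y in (0:ℝ)..x, (f y ^ 2)⁻¹ * (β + ∫ z in (0:ℝ)..y, f z * w1 z)
      = β * (∫ y in (0:ℝ)..x, (f y ^ 2)⁻¹)
        + ∫ y in (0:ℝ)..x, (f y ^ 2)⁻¹ * ∫ z in (0:ℝ)..y, f z * w1 z := by
    rw [← intervalIntegral.integral_const_mul, ← intervalIntegral.integral_add]
    · congr 1; ext y; ring
    · exact (cf2.const_mul β).intervalIntegrable _ _
    · exact (cf2.mul cP).intervalIntegrable _ _
  have e3 : w x / f x = w 0 + (β * (∫ y in (0:ℝ)..x, (f y ^ 2)⁻¹)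
        + ∫ y in (0:ℝ)..x, (f y ^ 2)⁻¹ * ∫ z in (0:ℝ)..y, f z * w1 z) := by
    rw [← e2, ← hYx]; simp only [hY]; ring
  rw [div_eq_iff (hne x)] at e3
  change w x = w 0 * f x + β * phiOne f x + Sop f w1 x
  rw [e3, phiOne, Sop]
  ring


/-! ### Convolutions in time and the core approximation -/

noncomputable def Wk (u : ℝ × ℝ → ℝ) (T : ℝ) (κ : ℝ → ℝ) (t x : ℝ) : ℝ :=
  ∫ τ in (0 : ℝ)..T, κ (t - τ) * u (x, τ)

noncomputable def betaK (f : ℝ → ℝ) (u : ℝ × ℝ → ℝ) (T x1 : ℝ) (κ : ℕ → ℝ → ℝ) (t : ℝ) (k : ℕ) : ℝ :=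
  (Wk u T (κ k) t x1 - f x1 * Wk u T (κ k) t 0 - Sop f (Wk u T (κ (k + 1)) t) x1) / phiOne f x1

theorem Wk_continuous {u : ℝ × ℝ → ℝ} (hu : Continuous u) {κ : ℝ → ℝ} (hκ : Continuous κ) (T t : ℝ) :
    Continuous (Wk u T κ t) := by
  apply intervalIntegral.continuous_parametric_intervalIntegral_of_continuous'
  simp only [Function.uncurry_def]
  fun_prop

theorem Wk_bound {u : ℝ × ℝ → ℝ} {κ : ℝ → ℝ} {T t x e U : ℝ} (hT : 0 < T)
    (ht : t ∈ Set.Icc 0 T)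
    (hU : ∀ τ ∈ Set.Icc 0 T, |u (x, τ)| ≤ U) (hd : ∀ z ∈ Set.Icc (-T) T, |κ z| ≤ e) :
    |Wk u T κ t x| ≤ e * (U * T) := by
  have h := intervalIntegral.norm_integral_le_of_norm_le_const (a := 0) (b := T) (C := e * U)
    (f := fun τ => κ (t - τ) * u (x, τ)) (by
      intro τ hτ
      rw [Set.uIoc_of_le hT.le] at hτ
      rw [Real.norm_eq_abs, abs_mul]
      have h1 := hd (t - τ) ⟨by linarith [ht.1, hτ.2], by linarith [ht.2, hτ.1]⟩
      have h2 := hU τ ⟨hτ.1.le, hτ.2⟩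
      exact mul_le_mul h1 h2 (abs_nonneg _) ((abs_nonneg _).trans h1))
  rw [sub_zero, abs_of_pos hT, Real.norm_eq_abs] at h
  unfold Wk
  linarith

theorem Wk_sub {u : ℝ × ℝ → ℝ} (hu : Continuous u) {κ ρ : ℝ → ℝ} (hκ : Continuous κ)
    (hρ : Continuous ρ) (T t x : ℝ) :
    Wk u T κ t x - Wk u T ρ t x = Wk u T (fun z => κ z - ρ z) t x := by
  unfold Wk
  rw [← intervalIntegral.integral_sub]
  · congr 1; ext τ; ring
  · exact (by fun_prop : Continuous _).intervalIntegrable _ _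
  · exact (by fun_prop : Continuous _).intervalIntegrable _ _

theorem betaK_diff {f : ℝ → ℝ} (hf : Continuous f) (hne : ∀ x, f x ≠ 0) {M m L : ℝ} (hM : ∀ x, |f x| ≤ M)
    (hm : ∀ x, |(f x ^ 2)⁻¹| ≤ m) {u : ℝ × ℝ → ℝ} (hu : Continuous u) {T U : ℝ} (hT : 0 < T)
    (hU : ∀ x ∈ Set.Icc 0 L, ∀ τ ∈ Set.Icc 0 T, |u (x, τ)| ≤ U) {κ ρ : ℕ → ℝ → ℝ}
    (hκ : ∀ k, Continuous (κ k)) (hρ : ∀ k, Continuous (ρ k)) {e : ℕ → ℝ}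
    (hd : ∀ k, ∀ z ∈ Set.Icc (-T) T, |κ k z - ρ k z| ≤ e k) {x1 : ℝ} (hx1 : x1 ∈ Set.Icc 0 L)
    {t : ℝ} (ht : t ∈ Set.Icc 0 T) (k : ℕ) :
    |betaK f u T x1 κ t k - betaK f u T x1 ρ t k| ≤
      ((1 + M + M * m * M * L ^ 2) * (U * T) / |phiOne f x1|) * (e k + e (k + 1)) := by
  have hL : 0 ≤ L := hx1.1.trans hx1.2
  have hM0 : 0 ≤ M := (abs_nonneg _).trans (hM 0)
  have hm0 : 0 ≤ m := (abs_nonneg _).trans (hm 0)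
  have hU0 : 0 ≤ U := (abs_nonneg _).trans (hU x1 hx1 0 ⟨le_rfl, hT.le⟩)
  have he0 : ∀ k, 0 ≤ e k := fun k => (abs_nonneg _).trans (hd k 0 ⟨by linarith, hT.le⟩)
  have hb : ∀ k, ∀ x ∈ Set.Icc 0 L, |Wk u T (κ k) t x - Wk u T (ρ k) t x| ≤ e k * (U * T) := by
    intro k x hx
    rw [Wk_sub hu (hκ k) (hρ k)]
    exact Wk_bound hT ht (hU x hx) (hd k)
  have h1 := hb k x1 hx1
  have h2 := hb k 0 ⟨le_rfl, hL⟩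
  have h3 : |Sop f (Wk u T (κ (k + 1)) t) x1 - Sop f (Wk u T (ρ (k + 1)) t) x1|
      ≤ e (k + 1) * (U * T) * (M * m * M * L ^ 2) := by
    have hc1 := Wk_continuous hu (hκ (k + 1)) T t
    have hc2 := Wk_continuous hu (hρ (k + 1)) T t
    have := Sop_lin hf hne hc1 hc2 1 (-1) x1
    have e1 : Sop f (Wk u T (κ (k + 1)) t) x1 - Sop f (Wk u T (ρ (k + 1)) t) x1
      = Sop f (fun z => 1 * Wk u T (κ (k + 1)) t z + -1 * Wk u T (ρ (k + 1)) t z) x1 := by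
      rw [this]; ring
    rw [e1]
    have h := Sop_iter_bound' hf hne (w := fun z => 1 * Wk u T (κ (k + 1)) t z + -1 * Wk u T (ρ (k + 1)) t z)
      (by fun_prop) (c := e (k + 1) * (U * T)) (L := L) hM hm L le_rfl (by
        intro x hx
        have := hb (k + 1) x hx
        simpa [sub_eq_add_neg] using this) 1 x1 hx1
    simp only [Function.iterate_one, pow_one, mul_one] at h
    refine h.trans ?_
    apply mul_le_mul_of_nonneg_left _ (by have := he0 (k+1); positivity)
    apply div_le_self (by positivity)
    simp
  have hnum : |(Wk u T (κ k) t x1 - f x1 * Wk u T (κ k) t 0 - Sop f (Wk u T (κ (k + 1)) t) x1)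
      - (Wk u T (ρ k) t x1 - f x1 * Wk u T (ρ k) t 0 - Sop f (Wk u T (ρ (k + 1)) t) x1)|
      ≤ (1 + M + M * m * M * L ^ 2) * (U * T) * (e k + e (k + 1)) := by
    have h2' : |f x1 * (Wk u T (κ k) t 0 - Wk u T (ρ k) t 0)| ≤ M * (e k * (U * T)) := by
      rw [abs_mul]; exact mul_le_mul (hM x1) h2 (abs_nonneg _) hM0
    have e2 : (Wk u T (κ k) t x1 - f x1 * Wk u T (κ k) t 0 - Sop f (Wk u T (κ (k + 1)) t) x1)
      - (Wk u T (ρ k) t x1 - f x1 * Wk u T (ρ k) t 0 - Sop f (Wk u T (ρ (k + 1)) t) x1)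
      = (Wk u T (κ k) t x1 - Wk u T (ρ k) t x1) - f x1 * (Wk u T (κ k) t 0 - Wk u T (ρ k) t 0)
        - (Sop f (Wk u T (κ (k + 1)) t) x1 - Sop f (Wk u T (ρ (k + 1)) t) x1) := by ring
    rw [e2]
    refine (abs_sub _ _).trans ((add_le_add_left (abs_sub _ _) _).trans ?_)
    have p1 : 0 ≤ e (k + 1) * (U * T) := by have := he0 (k+1); positivity
    have p2 : 0 ≤ M * (e (k + 1) * (U * T)) := by positivity
    have p3 : 0 ≤ (M * m * M * L ^ 2) * (e k * (U * T)) := by have := he0 k; positivity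
    linarith
  unfold betaK
  rw [← sub_div, abs_div, div_mul_eq_mul_div]
  exact div_le_div_of_nonneg_right hnum (abs_nonneg _)

theorem Wk_expand {u : ℝ × ℝ → ℝ} (hu : Continuous u) {κ : ℕ → ℝ → ℝ} {N : ℕ}
    (hκ : ∀ k, Continuous (κ k))
    (hexp : ∀ k t τ, κ k (t - τ) = ∑ j ∈ Finset.range N, t ^ j / j.factorial * κ (k + j) (-τ))
    (T t : ℝ) (k : ℕ) (x : ℝ) :
    Wk u T (κ k) t x = ∑ j ∈ Finset.range N, t ^ j / j.factorial * Wk u T (κ (k + j)) 0 x := by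
  unfold Wk
  simp only [zero_sub]
  have : ∀ τ, κ k (t - τ) * u (x, τ) = ∑ j ∈ Finset.range N, t ^ j / j.factorial *
      (κ (k + j) (-τ) * u (x, τ)) := by
    intro τ
    rw [hexp, Finset.sum_mul]
    apply Finset.sum_congr rfl
    intro j _; ring
  simp only [this]
  rw [intervalIntegral.integral_finsetSum]
  · apply Finset.sum_congr rfl
    intro j _
    rw [intervalIntegral.integral_const_mul]
  · intro j _
    have := hκ (k + j)
    exact (by fun_prop : Continuous _).intervalIntegrable _ _

theorem betaK_expand {f : ℝ → ℝ} (hf : Continuous f) (hne : ∀ x, f x ≠ 0)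
    {u : ℝ × ℝ → ℝ} (hu : Continuous u) {κ : ℕ → ℝ → ℝ} {N : ℕ}
    (hκ : ∀ k, Continuous (κ k))
    (hexp : ∀ k t τ, κ k (t - τ) = ∑ j ∈ Finset.range N, t ^ j / j.factorial * κ (k + j) (-τ))
    (T t x1 : ℝ) (k : ℕ) :
    betaK f u T x1 κ t k = ∑ j ∈ Finset.range N, t ^ j / j.factorial * betaK f u T x1 κ 0 (k + j) := by
  have hS : Sop f (Wk u T (κ (k + 1)) t) x1
      = ∑ j ∈ Finset.range N, t ^ j / j.factorial * Sop f (Wk u T (κ (k + j + 1)) 0) x1 := by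
    have : Wk u T (κ (k + 1)) t = fun z => ∑ j ∈ Finset.range N, t ^ j / j.factorial *
        Wk u T (κ (k + j + 1)) 0 z := by
      ext z
      rw [Wk_expand hu hκ hexp]
      apply Finset.sum_congr rfl
      intro j _
      rw [show k + 1 + j = k + j + 1 by ring]
    rw [this, Sop_sum hf hne N (fun j => t ^ j / j.factorial) (fun j => Wk u T (κ (k + j + 1)) 0)
      (fun j => Wk_continuous hu (hκ _) T 0)]
  unfold betaK
  rw [hS, Wk_expand hu hκ hexp T t k x1, Wk_expand hu hκ hexp T t k 0, Finset.mul_sum,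
    ← Finset.sum_sub_distrib, ← Finset.sum_sub_distrib, Finset.sum_div]
  apply Finset.sum_congr rfl
  intro j _
  ring

theorem Wk_local {u : ℝ × ℝ → ℝ} {ρ : ℝ → ℝ} {δ T t : ℝ} (hδ : 0 < δ) (hδt : δ ≤ t) (htT : t ≤ T)
    (h0 : ∀ x, x ∉ Set.Ioo 0 δ → ρ x = 0) (x : ℝ) :
    Wk u T ρ t x = ∫ τ in (t - δ)..t, ρ (t - τ) * u (x, τ) := by
  have hs : Function.support (fun τ => ρ (t - τ) * u (x, τ)) ⊆ Set.Ioo (t - δ) t := by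
    intro τ hτ
    by_contra hc
    apply hτ
    simp only
    rw [h0, zero_mul]
    intro h
    exact hc ⟨by linarith [h.2], by linarith [h.1]⟩
  unfold Wk
  rw [intervalIntegral.integral_eq_integral_of_support_subset,
    intervalIntegral.integral_eq_integral_of_support_subset]
  · exact hs.trans (fun y hy => ⟨hy.1, hy.2.le⟩)
  · exact hs.trans (fun y hy => ⟨by linarith [hy.1], by linarith [hy.2]⟩)

theorem mollify_close {u : ℝ × ℝ → ℝ} (hu : Continuous u) {ρ : ℝ → ℝ} (hρ : Continuous ρ)
    {δ T t x η : ℝ} (hδ : 0 < δ) (hδt : δ ≤ t) (htT : t ≤ T)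
    (h0 : ∀ x, x ∉ Set.Ioo 0 δ → ρ x = 0) (hpos : ∀ x, 0 ≤ ρ x) (hone : ∫ x in (0 : ℝ)..δ, ρ x = 1)
    (hη : ∀ τ ∈ Set.Icc (t - δ) t, |u (x, t) - u (x, τ)| ≤ η) :
    |u (x, t) - Wk u T ρ t x| ≤ η := by
  rw [Wk_local hδ hδt htT h0]
  have hone' : ∫ τ in (t - δ)..t, ρ (t - τ) = 1 := by
    rw [intervalIntegral.integral_comp_sub_left]
    simpa using hone
  have e1 : u (x, t) - ∫ τ in (t - δ)..t, ρ (t - τ) * u (x, τ)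
      = ∫ τ in (t - δ)..t, ρ (t - τ) * (u (x, t) - u (x, τ)) := by
    simp only [mul_sub]
    rw [intervalIntegral.integral_sub, intervalIntegral.integral_mul_const, hone', one_mul]
    · exact (by fun_prop : Continuous _).intervalIntegrable _ _
    · exact (by fun_prop : Continuous _).intervalIntegrable _ _
  rw [e1]
  have hle : t - δ ≤ t := by linarith
  refine (intervalIntegral.abs_integral_le_integral_abs hle).trans ?_
  have : ∫ τ in (t - δ)..t, |ρ (t - τ) * (u (x, t) - u (x, τ))| ≤ ∫ τ in (t - δ)..t, ρ (t - τ) * η := by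
    apply intervalIntegral.integral_mono_on hle
    · exact (by fun_prop : Continuous _).intervalIntegrable _ _
    · exact (by fun_prop : Continuous _).intervalIntegrable _ _
    · intro τ hτ
      rw [abs_mul, abs_of_nonneg (hpos _)]
      exact mul_le_mul_of_nonneg_left (hη τ hτ) (hpos _)
  rwa [intervalIntegral.integral_mul_const, hone', one_mul] at this

theorem phiOne_ne_zero {f : ℝ → ℝ} (hf : Continuous f) (hne : ∀ x, f x ≠ 0) {x : ℝ} (hx : 0 < x) :
    phiOne f x ≠ 0 := by
  unfold phiOne
  apply mul_ne_zero (hne x)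
  apply ne_of_gt
  have h2 : Continuous (fun y => (f y ^ 2)⁻¹) :=
    (hf.pow 2).inv₀ (fun x => pow_ne_zero _ (hne x))
  apply intervalIntegral.intervalIntegral_pos_of_pos (h2.intervalIntegrable _ _) _ hx
  intro y
  have := hne y
  positivity

theorem majorant_bounds {B C A : ℝ} (hB : 0 ≤ B) (hC : 0 < C) (hA : A = 288 * B + 1) (k : ℕ) :
    (C * ((k.factorial : ℝ) ^ 2 * (9 / A) ^ k)) * (B ^ k / (2 * k).factorial) ≤ C * (1 / 2) ^ k ∧
    (C * (((k + 1).factorial : ℝ) ^ 2 * (9 / A) ^ (k + 1))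
      + C * (((k + 2).factorial : ℝ) ^ 2 * (9 / A) ^ (k + 2))) * (B ^ k / (2 * k).factorial)
      ≤ (16 * C * (9 / A + (9 / A) ^ 2)) * (1 / 2) ^ k := by
  have hA0 : 0 < A := by rw [hA]; positivity
  set r := 9 / A with hr
  have hr0 : 0 < r := by positivity
  have hrB : 16 * (r * B) ≤ 1 / 2 := by
    rw [hr, div_mul_eq_mul_div, mul_div_assoc', div_le_iff₀ hA0, hA]
    linarith
  have hrB0 : 0 ≤ r * B := by positivity
  have hfac : ((k.factorial : ℝ) ^ 2) / (2 * k).factorial ≤ 1 := by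
    rw [div_le_one (by positivity)]
    have := Nat.le_of_dvd (Nat.factorial_pos _) (Nat.factorial_mul_factorial_dvd_factorial_add k k)
    rw [← two_mul] at this
    rw [sq]
    exact_mod_cast this
  have hfac0 : 0 ≤ ((k.factorial : ℝ) ^ 2) / (2 * k).factorial := by positivity
  have hpow : (16:ℝ) ^ k * (r * B) ^ k ≤ (1 / 2) ^ k := by
    rw [← mul_pow]; exact pow_le_pow_left₀ (by positivity) hrB k
  have hk2 : ((k : ℝ) + 2) ≤ 2 * 2 ^ k := by
    have : ∀ k : ℕ, k + 2 ≤ 2 * 2 ^ k := by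
      intro k
      induction k with
      | zero => simp
      | succ n ih => rw [pow_succ]; omega
    exact_mod_cast this k
  have hk4 : ((k : ℝ) + 2) ^ 4 ≤ 16 * 16 ^ k := by
    calc ((k : ℝ) + 2) ^ 4 ≤ (2 * 2 ^ k) ^ 4 := pow_le_pow_left₀ (by positivity) hk2 4
      _ = 16 * 16 ^ k := by rw [mul_pow, ← pow_mul, mul_comm k 4, pow_mul]; norm_num
  constructor
  · have : (C * ((k.factorial : ℝ) ^ 2 * r ^ k)) * (B ^ k / (2 * k).factorial)
        = C * (((k.factorial : ℝ) ^ 2) / (2 * k).factorial * (r * B) ^ k) := by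
      rw [mul_pow]; ring
    rw [this]
    apply mul_le_mul_of_nonneg_left _ hC.le
    calc _ ≤ 1 * (r * B) ^ k := mul_le_mul_of_nonneg_right hfac (by positivity)
      _ ≤ (1 / 2) ^ k := by
        rw [one_mul]
        exact pow_le_pow_left₀ hrB0 (by linarith) k
  · have e : (C * (((k + 1).factorial : ℝ) ^ 2 * r ^ (k + 1))
      + C * (((k + 2).factorial : ℝ) ^ 2 * r ^ (k + 2))) * (B ^ k / (2 * k).factorial)
      = C * (((k.factorial : ℝ) ^ 2) / (2 * k).factorial) * (r * B) ^ k *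
        (((k:ℝ) + 1) ^ 2 * r + ((k:ℝ) + 1) ^ 2 * ((k:ℝ) + 2) ^ 2 * r ^ 2) := by
      rw [Nat.factorial_succ (k + 1), Nat.factorial_succ k]
      push_cast
      rw [mul_pow r B]
      ring
    rw [e]
    have hk0 : (0:ℝ) ≤ k := Nat.cast_nonneg k
    have q1 : ((k:ℝ) + 1) ^ 2 ≤ ((k : ℝ) + 2) ^ 4 := by
      calc ((k:ℝ) + 1) ^ 2 ≤ ((k:ℝ) + 2) ^ 2 := pow_le_pow_left₀ (by positivity) (by linarith) 2
        _ ≤ ((k:ℝ) + 2) ^ 4 := pow_le_pow_right₀ (by linarith) (by norm_num)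
    have q2 : ((k:ℝ) + 1) ^ 2 * ((k:ℝ) + 2) ^ 2 ≤ ((k : ℝ) + 2) ^ 4 := by
      calc _ ≤ ((k:ℝ) + 2) ^ 2 * ((k:ℝ) + 2) ^ 2 := by gcongr; linarith
        _ = ((k:ℝ) + 2) ^ 4 := by ring
    calc C * (((k.factorial : ℝ) ^ 2) / (2 * k).factorial) * (r * B) ^ k *
        (((k:ℝ) + 1) ^ 2 * r + ((k:ℝ) + 1) ^ 2 * ((k:ℝ) + 2) ^ 2 * r ^ 2)
        ≤ C * 1 * (r * B) ^ k * ((16 * 16 ^ k) * r + (16 * 16 ^ k) * r ^ 2) := by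
          have s1 : ((k:ℝ) + 1) ^ 2 * r ≤ (16 * 16 ^ k) * r :=
            mul_le_mul_of_nonneg_right (q1.trans hk4) hr0.le
          have s2 : ((k:ℝ) + 1) ^ 2 * ((k:ℝ) + 2) ^ 2 * r ^ 2 ≤ (16 * 16 ^ k) * r ^ 2 :=
            mul_le_mul_of_nonneg_right (q2.trans hk4) (by positivity)
          exact mul_le_mul (by gcongr) (add_le_add s1 s2) (by positivity) (by positivity)
      _ = (16 * C * (r + r ^ 2)) * ((16:ℝ) ^ k * (r * B) ^ k) := by ring
      _ ≤ _ := by gcongr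


theorem core_approx {f f' q : ℝ → ℝ} (hf : Continuous f) (hne : ∀ x, f x ≠ 0) (hf0 : f 0 = 1)
    {M m L T : ℝ} (hL : 0 < L) (hT : 0 < T) (hM : ∀ x, |f x| ≤ M) (hm : ∀ x, |(f x ^ 2)⁻¹| ≤ m)
    (hfd : ∀ x ∈ Set.Ioo 0 L, HasDerivAt f (f' x) x)
    (hfd' : ∀ x ∈ Set.Ioo 0 L, HasDerivAt f' (q x * f x) x)
    {u ux uxx ut : ℝ × ℝ → ℝ} (hu : Continuous u) {D Dc : Set (ℝ × ℝ)}
    (hux : ∀ p ∈ D, HasDerivAt (fun x => u (x, p.2)) (ux p) p.1)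
    (huxx : ∀ p ∈ D, HasDerivAt (fun x => ux (x, p.2)) (uxx p) p.1)
    (hut : ∀ p ∈ D, HasDerivAt (fun t => u (p.1, t)) (ut p) p.2)
    (hux_cont : ContinuousOn ux D)
    (huxx_cont : ContinuousOn uxx D)
    (hut_cont : ContinuousOn ut D)
    (heq : ∀ p ∈ D, uxx p - q p.1 * u p = ut p)
    {x1 δ ε : ℝ} (hx1 : 0 < x1) (hδ : 0 < δ) (hε : 0 < ε)
    (hDc : ∀ x t, (x, t) ∈ Dc → x1 ≤ x ∧ x ≤ L ∧ δ ≤ t ∧ t ≤ T ∧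
      (∀ y ∈ Set.Ioo 0 x, ∀ τ ∈ Set.Icc (t - δ) t, (y, τ) ∈ D) ∧
      ∀ τ ∈ Set.Icc (t - δ) t, |u (x, t) - u (x, τ)| ≤ ε / 4) :
    ∃ (N : ℕ) (a : ℕ → ℝ), ∀ p ∈ Dc,
      |u p - ∑ n ∈ Finset.range (N + 1), a n * transmutedHeatPolyR f n p.1 p.2| < ε := by
  by_cases hemp : Dc = ∅
  · exact ⟨0, fun _ => 0, by simp [hemp]⟩
  have hx1L : x1 ≤ L := by
    obtain ⟨⟨x, t⟩, hp⟩ := Set.nonempty_iff_ne_empty.2 hemp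
    have := hDc x t hp
    linarith [this.1, this.2.1]
  have hx1m : x1 ∈ Set.Icc 0 L := ⟨hx1.le, hx1L⟩
  have hM0 : 0 ≤ M := (abs_nonneg _).trans (hM 0)
  have hm0 : 0 ≤ m := (abs_nonneg _).trans (hm 0)
  obtain ⟨U, hU'⟩ := ((isCompact_Icc (a := (0:ℝ)) (b := L)).prod
    (isCompact_Icc (a := (0:ℝ)) (b := T))).exists_bound_of_continuousOn hu.continuousOn
  have hU : ∀ x ∈ Set.Icc 0 L, ∀ τ ∈ Set.Icc 0 T, |u (x, τ)| ≤ U := fun x hx τ hτ =>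
    hU' (x, τ) ⟨hx, hτ⟩
  have hU0 : 0 ≤ U := (abs_nonneg _).trans (hU 0 ⟨le_rfl, hL.le⟩ 0 ⟨le_rfl, hT.le⟩)
  obtain ⟨P, hP'⟩ := (isCompact_Icc (a := (0:ℝ)) (b := L)).exists_bound_of_continuousOn
    (phiOne_continuous hf hne).continuousOn
  have hP : ∀ x ∈ Set.Icc 0 L, |phiOne f x| ≤ P := fun x hx => hP' x hx
  have hP0 : 0 ≤ P := (abs_nonneg _).trans (hP 0 ⟨le_rfl, hL.le⟩)
  have hφ : phiOne f x1 ≠ 0 := phiOne_ne_zero hf hne hx1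
  set B := M * m * M * L ^ 2 with hB
  have hB0 : 0 ≤ B := by positivity
  obtain ⟨A, hA⟩ : ∃ A, A = 288 * B + 1 := ⟨_, rfl⟩
  have hA0 : 0 < A := by rw [hA]; positivity
  obtain ⟨ρ, C, hC, hρd, hρ0, hρpos, hρint, hρM⟩ := exists_bump A δ hA0 hδ
  have hρc : ∀ k, Continuous (ρ k) := fun k =>
    continuous_iff_continuousAt.2 fun x => (hρd k x).continuousAt
  set Mk : ℕ → ℝ := fun k => C * ((k.factorial : ℝ) ^ 2 * (9 / A) ^ k) with hMk
  have hMk0 : ∀ k, 0 ≤ Mk k := fun k => by simp only [hMk]; positivity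
  set K := (1 + M + B) * (U * T) / |phiOne f x1| with hK
  have hK0 : 0 ≤ K := by positivity
  set K' := U * T * M + K * P with hK'
  have hK'0 : 0 ≤ K' := by positivity
  set Γ := 2 * (16 * C * (9 / A + (9 / A) ^ 2)) with hΓ
  have hΓ0 : 0 ≤ Γ := by positivity
  obtain ⟨ε', hε', hε'2⟩ : ∃ ε' > 0, K' * ε' * Γ < ε / 4 := by
    refine ⟨ε / (4 * (K' * Γ + 1)), by positivity, ?_⟩
    have : K' * (ε / (4 * (K' * Γ + 1))) * Γ = ε / 4 * ((K' * Γ) / (K' * Γ + 1)) := by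
      field_simp
    rw [this]
    have h1 : (K' * Γ) / (K' * Γ + 1) < 1 := by
      rw [div_lt_one (by positivity)]; linarith
    have : 0 < ε / 4 := by positivity
    nlinarith
  obtain ⟨κ, N, hκc, hκN, hκexp, hκρ⟩ := approx_kernel ρ Mk δ T ε' hδ hT hε' hρd hρ0 hρM
  -- the span representation
  have hWzero : ∀ k, N ≤ k → ∀ t, Wk u T (κ k) t = fun _ => 0 := by
    intro k hk t; ext x
    simp [Wk, hκN k hk]
  have hbzero : ∀ k, N ≤ k → ∀ t, betaK f u T x1 κ t k = 0 := by
    intro k hk t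
    simp [betaK, hWzero k hk t, hWzero (k + 1) (by omega) t, Sop_zero]
  obtain ⟨a, ha⟩ := expand_mem_span hne N (fun k => Wk u T (κ k) 0 0) (fun k => betaK f u T x1 κ 0 k)
    (fun i hi => by rw [hWzero i hi]) (fun i hi => hbzero i hi 0)
  refine ⟨2 * N, a, ?_⟩
  rintro ⟨x, t⟩ hp
  obtain ⟨hx1x, hxL, hδt, htT, hrect, hosc⟩ := hDc x t hp
  have hx0 : 0 < x := hx1.trans_le hx1x
  have hxm : x ∈ Set.Icc 0 L := ⟨hx0.le, hxL⟩
  have htm : t ∈ Set.Icc 0 T := ⟨by linarith, htT⟩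
  simp only
  rw [← ha x t]
  -- step 1
  have s1 : |u (x, t) - Wk u T (ρ 0) t x| ≤ ε / 4 :=
    mollify_close hu (hρc 0) hδ hδt htT (hρ0 0) hρpos hρint hosc
  -- step 2 : expansion of the mollified solution
  have hid : ∀ k, ∀ y ∈ Set.Icc 0 x, Wk u T (ρ k) t y = Wk u T (ρ k) t 0 * f y
      + betaK f u T x1 ρ t k * phiOne f y + Sop f (Wk u T (ρ (k + 1)) t) y := by
    intro k
    have hmem : ∀ p ∈ Set.Ioo 0 x ×ˢ Set.Icc (t - δ) t, p ∈ D := fun p hp => hrect p.1 hp.1 p.2 hp.2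
    obtain ⟨β, hβ⟩ := key_identity (f' := f') (q := q) hf hne hf0 (b := x) (c := t - δ) (d := t) hx0 (by linarith)
      (fun y hy => hfd y ⟨hy.1, hy.2.trans_le hxL⟩) (fun y hy => hfd' y ⟨hy.1, hy.2.trans_le hxL⟩)
      (u := u) (ux := ux) (uxx := uxx) (ut := ut) hu
      (fun y hy τ hτ => hux (y, τ) (hrect y hy τ hτ)) (fun y hy τ hτ => huxx (y, τ) (hrect y hy τ hτ))
      (fun y hy τ hτ => hut (y, τ) (hrect y hy τ hτ))
      (hux_cont.mono hmem) (huxx_cont.mono hmem) (hut_cont.mono hmem)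
      (fun y hy τ hτ => heq (y, τ) (hrect y hy τ hτ))
      (κ := fun τ => ρ k (t - τ)) (κ' := fun τ => - ρ (k + 1) (t - τ))
      (fun τ => by
        have h1 := (hρd k (t - τ)).comp τ ((hasDerivAt_id τ).const_sub t)
        exact h1.congr_deriv (by simp))
      (by have := hρc (k + 1); fun_prop)
      (hρ0 k _ (by simp)) (hρ0 k _ (by simp))
    have hSe : (fun x => - ∫ τ in (t - δ)..t, - ρ (k + 1) (t - τ) * u (x, τ))
        = Wk u T (ρ (k + 1)) t := by
      ext y
      rw [Wk_local hδ hδt htT (hρ0 (k + 1))]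
      simp
    simp only [hSe, ← Wk_local hδ hδt htT (hρ0 k)] at hβ
    have hβe : betaK f u T x1 ρ t k = β := by
      have h := hβ x1 ⟨hx1.le, hx1x⟩
      unfold betaK
      rw [div_eq_iff hφ, h]; ring
    rw [hβe]
    exact hβ
  have hcW : ∀ k, Continuous (Wk u T (ρ k) t) := fun k => Wk_continuous hu (hρc k) T t
  have hexpand := fun n => Sop_expand hf hne (fun k => Wk u T (ρ k) t) hcW (fun k => Wk u T (ρ k) t 0)
    (fun k => betaK f u T x1 ρ t k) x hid n 0 x ⟨hx0.le, le_rfl⟩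
  simp only [zero_add] at hexpand
  -- remainder
  have hrem : ∀ n, |(Sop f)^[n] (Wk u T (ρ n) t) x| ≤ (U * T * C) * (1 / 2) ^ n := by
    intro n
    have h1 := Sop_iter_bound' hf hne (hcW n) hM hm L le_rfl
      (fun y hy => Wk_bound hT htm (hU y hy) (fun z _ => hρM n z)) n x hxm
    have h2 := (majorant_bounds hB0 hC hA n).1
    refine h1.trans ?_
    rw [← hB]
    calc _ = (U * T) * (C * ((n.factorial : ℝ) ^ 2 * (9 / A) ^ n) * (B ^ n / (2 * n).factorial)) := by ring
      _ ≤ (U * T) * (C * (1 / 2) ^ n) := mul_le_mul_of_nonneg_left h2 (by positivity)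
      _ = _ := by ring
  obtain ⟨n0, hn0⟩ : ∃ n0, ∀ n ≥ n0, (U * T * C) * (1 / 2 : ℝ) ^ n < ε / 4 := by
    have : Filter.Tendsto (fun n : ℕ => (U * T * C) * (1 / 2 : ℝ) ^ n) Filter.atTop (nhds ((U * T * C) * 0)) :=
      (tendsto_pow_atTop_nhds_zero_of_lt_one (by norm_num) (by norm_num)).const_mul _
    rw [mul_zero] at this
    exact Filter.eventually_atTop.1 (this.eventually (gt_mem_nhds (by positivity)))
  set n := max n0 N with hn
  have s2 : |Wk u T (ρ 0) t x - ∑ i ∈ Finset.range n, (Wk u T (ρ i) t 0 * (Sop f)^[i] f x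
      + betaK f u T x1 ρ t i * (Sop f)^[i] (phiOne f) x)| < ε / 4 := by
    rw [hexpand n]
    rw [add_sub_cancel_left]
    exact (hrem n).trans_lt (hn0 n (le_max_left _ _))
  -- step 3: kernel replacement
  have s3 : |∑ i ∈ Finset.range n, (Wk u T (ρ i) t 0 * (Sop f)^[i] f x
      + betaK f u T x1 ρ t i * (Sop f)^[i] (phiOne f) x)
      - ∑ i ∈ Finset.range n, (Wk u T (κ i) t 0 * (Sop f)^[i] f x
      + betaK f u T x1 κ t i * (Sop f)^[i] (phiOne f) x)| < ε / 4 := by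
    rw [← Finset.sum_sub_distrib]
    refine lt_of_le_of_lt ?_ hε'2
    refine (Finset.abs_sum_le_sum_abs _ _).trans ?_
    have hterm : ∀ i ∈ Finset.range n, |(Wk u T (ρ i) t 0 * (Sop f)^[i] f x
      + betaK f u T x1 ρ t i * (Sop f)^[i] (phiOne f) x) - (Wk u T (κ i) t 0 * (Sop f)^[i] f x
      + betaK f u T x1 κ t i * (Sop f)^[i] (phiOne f) x)| ≤
        K' * ε' * ((16 * C * (9 / A + (9 / A) ^ 2)) * (1 / 2) ^ i) := by
      intro i _
      have d1 : |Wk u T (κ i) t 0 - Wk u T (ρ i) t 0| ≤ ε' * Mk (i + 1) * (U * T) := by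
        rw [Wk_sub hu (hκc i) (hρc i)]
        exact Wk_bound hT htm (hU 0 ⟨le_rfl, hL.le⟩) (hκρ i)
      have d2 := betaK_diff hf hne hM hm hu hT hU hκc hρc (e := fun k => ε' * Mk (k + 1))
        hκρ hx1m htm i
      rw [← hB, ← hK] at d2
      have b1 := Sop_iter_bound' hf hne hf hM hm L le_rfl (fun y _ => hM y) i x hxm
      have b2 := Sop_iter_bound' hf hne (phiOne_continuous hf hne) hM hm L le_rfl hP i x hxm
      rw [← hB] at b1 b2
      have g := (majorant_bounds hB0 hC hA i).2
      set F := B ^ i / ((2 * i).factorial : ℝ) with hF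
      have hF0 : 0 ≤ F := by positivity
      have e1 : (Wk u T (ρ i) t 0 * (Sop f)^[i] f x
        + betaK f u T x1 ρ t i * (Sop f)^[i] (phiOne f) x) - (Wk u T (κ i) t 0 * (Sop f)^[i] f x
        + betaK f u T x1 κ t i * (Sop f)^[i] (phiOne f) x)
        = -((Wk u T (κ i) t 0 - Wk u T (ρ i) t 0) * (Sop f)^[i] f x
          + (betaK f u T x1 κ t i - betaK f u T x1 ρ t i) * (Sop f)^[i] (phiOne f) x) := by ring
      rw [e1, abs_neg]
      refine (abs_add_le _ _).trans ?_
      rw [abs_mul, abs_mul]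
      have hM1 := hMk0 (i + 1)
      have hM2 := hMk0 (i + 2)
      have t1 := mul_le_mul d1 b1 (abs_nonneg _) (by positivity)
      have t2 := mul_le_mul d2 b2 (abs_nonneg _) (by
        have : 0 ≤ Mk (i + 1 + 1) := hMk0 _
        positivity)
      refine (add_le_add t1 t2).trans ?_
      have g' : (Mk (i + 1) + Mk (i + 2)) * F ≤ (16 * C * (9 / A + (9 / A) ^ 2)) * (1 / 2) ^ i := g
      calc ε' * Mk (i + 1) * (U * T) * (M * F) + K * (ε' * Mk (i + 1) + ε' * Mk (i + 1 + 1)) * (P * F)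
          = U * T * M * ε' * (Mk (i + 1) * F) + K * P * ε' * ((Mk (i + 1) + Mk (i + 2)) * F) := by ring
        _ ≤ U * T * M * ε' * ((Mk (i + 1) + Mk (i + 2)) * F)
            + K * P * ε' * ((Mk (i + 1) + Mk (i + 2)) * F) := by
            gcongr
            linarith
        _ = K' * ε' * ((Mk (i + 1) + Mk (i + 2)) * F) := by rw [hK']; ring
        _ ≤ _ := mul_le_mul_of_nonneg_left g' (by positivity)
    refine (Finset.sum_le_sum hterm).trans ?_
    rw [← Finset.mul_sum, ← Finset.mul_sum]
    have hgeo : ∑ i ∈ Finset.range n, (1 / 2 : ℝ) ^ i ≤ 2 := by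
      rw [geom_sum_eq (by norm_num)]
      have : 0 < (1 / 2 : ℝ) ^ n := by positivity
      rw [div_le_iff_of_neg (by norm_num)]
      linarith
    have : 0 ≤ 16 * C * (9 / A + (9 / A) ^ 2) := by positivity
    rw [hΓ]
    apply mul_le_mul_of_nonneg_left _ (by positivity)
    nlinarith
  -- step 4 : identification
  have s4 : ∑ i ∈ Finset.range n, (Wk u T (κ i) t 0 * (Sop f)^[i] f x
      + betaK f u T x1 κ t i * (Sop f)^[i] (phiOne f) x)
      = ∑ k ∈ Finset.range N,
        ((∑ j ∈ Finset.range N, t ^ j / j.factorial * Wk u T (κ (k + j)) 0 0) * (Sop f)^[k] f x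
        + (∑ j ∈ Finset.range N, t ^ j / j.factorial * betaK f u T x1 κ 0 (k + j))
          * (Sop f)^[k] (phiOne f) x) := by
    rw [← Finset.sum_subset (Finset.range_mono (le_max_right n0 N))]
    · apply Finset.sum_congr rfl
      intro k _
      rw [← Wk_expand hu hκc hκexp, ← betaK_expand hf hne hu hκc hκexp]
    · intro k _ hk
      have hk : N ≤ k := by simpa using hk
      rw [hWzero k hk, hbzero k hk]; simp
  rw [← s4]
  have t1 := abs_sub_le (u (x, t)) (Wk u T (ρ 0) t x) (∑ i ∈ Finset.range n, (Wk u T (ρ i) t 0 * (Sop f)^[i] f x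
      + betaK f u T x1 ρ t i * (Sop f)^[i] (phiOne f) x))
  have t2 := abs_sub_le (u (x, t)) (∑ i ∈ Finset.range n, (Wk u T (ρ i) t 0 * (Sop f)^[i] f x
      + betaK f u T x1 ρ t i * (Sop f)^[i] (phiOne f) x))
      (∑ i ∈ Finset.range n, (Wk u T (κ i) t 0 * (Sop f)^[i] f x
      + betaK f u T x1 κ t i * (Sop f)^[i] (phiOne f) x))
  linarith

/-- Completeness of the transmuted heat polynomials: any classical solution of
`u_xx - q u = u_t` in `D(s)`, continuous on the closure of `D(s)`, can be
uniformly approximated on every compact subset of `D(s)` by finite linear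
combinations `Σ_{n=0}^N a_n H_n`. -/
theorem transmutedHeatPolys_complete (L T : ℝ) (hL : 0 < L) (hT : 0 < T)
    (q f f' : ℝ → ℝ)
    (hq : ContinuousOn q (Set.Icc 0 L))
    (hf : ∀ x ∈ Set.Icc (0 : ℝ) L, HasDerivWithinAt f (f' x) (Set.Icc 0 L) x)
    (hf' : ∀ x ∈ Set.Icc (0 : ℝ) L, HasDerivWithinAt f' (q x * f x) (Set.Icc 0 L) x)
    (hf0 : f 0 = 1)
    (hfne : ∀ x ∈ Set.Icc (0 : ℝ) L, f x ≠ 0)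
    (s : ℝ → ℝ) (hs : ContDiffOn ℝ 1 s (Set.Icc 0 T))
    (hs_pos : ∀ t ∈ Set.Ico (0 : ℝ) T, 0 < s t ∧ s t ≤ L)
    (D : Set (ℝ × ℝ))
    (hD : D = {p : ℝ × ℝ | 0 < p.1 ∧ p.1 < s p.2 ∧ 0 < p.2 ∧ p.2 < T})
    (u ux uxx ut : ℝ × ℝ → ℝ)
    (hu_cont : ContinuousOn u (closure D))
    (hux : ∀ p ∈ D, HasDerivAt (fun x => u (x, p.2)) (ux p) p.1)
    (huxx : ∀ p ∈ D, HasDerivAt (fun x => ux (x, p.2)) (uxx p) p.1)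
    (hut : ∀ p ∈ D, HasDerivAt (fun t => u (p.1, t)) (ut p) p.2)
    (hux_cont : ContinuousOn ux D)
    (huxx_cont : ContinuousOn uxx D)
    (hut_cont : ContinuousOn ut D)
    (heq : ∀ p ∈ D, uxx p - q p.1 * u p = ut p) :
    ∀ Dc : Set (ℝ × ℝ), IsCompact Dc → Dc ⊆ D →
      ∀ ε : ℝ, 0 < ε →
        ∃ (N : ℕ) (a : ℕ → ℝ), ∀ p ∈ Dc,
          |u p - ∑ n ∈ Finset.range (N + 1), a n * transmutedHeatPolyR f n p.1 p.2| < ε := by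
  have hcs : ContinuousOn s (Set.Icc 0 T) := hs.continuousOn
  have hDo : IsOpen D := by
    have ho : IsOpen {p : ℝ × ℝ | 0 < p.1 ∧ 0 < p.2 ∧ p.2 < T} :=
      (isOpen_lt continuous_const continuous_fst).inter
        ((isOpen_lt continuous_const continuous_snd).inter (isOpen_lt continuous_snd continuous_const))
    have hc : ContinuousOn (fun p : ℝ × ℝ => s p.2 - p.1) {p : ℝ × ℝ | 0 < p.1 ∧ 0 < p.2 ∧ p.2 < T} :=
      (hcs.comp continuousOn_snd (fun p hp => ⟨hp.2.1.le, hp.2.2.le⟩)).sub continuousOn_fst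
    have h := hc.isOpen_inter_preimage ho (isOpen_Ioi (a := (0:ℝ)))
    have e : D = {p : ℝ × ℝ | 0 < p.1 ∧ 0 < p.2 ∧ p.2 < T}
        ∩ (fun p : ℝ × ℝ => s p.2 - p.1) ⁻¹' Set.Ioi 0 := by
      rw [hD]; ext p
      simp only [Set.mem_ofPred_eq, Set.mem_inter_iff, Set.mem_preimage, Set.mem_Ioi, sub_pos]
      tauto
    rw [e]; exact h
  have hDmono : ∀ x t y, (x, t) ∈ D → 0 < y → y < x → (y, t) ∈ D := by
    intro x t y h h0 h1
    rw [hD] at h ⊢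
    exact ⟨h0, h1.trans h.2.1, h.2.2⟩
  have hDL : ∀ x t, (x, t) ∈ D → 0 < x ∧ x ≤ L ∧ 0 < t ∧ t < T := by
    intro x t h
    rw [hD] at h
    obtain ⟨h1, h2, h3, h4⟩ := h
    simp only at h1 h2 h3 h4
    exact ⟨h1, by linarith [(hs_pos t ⟨h3.le, h4⟩).2], h3, h4⟩
  intro Dc hDc hDcD ε hε
  by_cases hemp : Dc = ∅
  · exact ⟨0, fun _ => 0, by simp [hemp]⟩
  have hnonempty := Set.nonempty_iff_ne_empty.2 hemp
  -- extension of `f`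
  have hfc : ContinuousOn f (Set.Icc 0 L) := fun x hx => (hf x hx).continuousWithinAt
  obtain ⟨g, hgc, hgf, hgne, M, m, hM, hm⟩ : ∃ g : ℝ → ℝ, Continuous g ∧
      (∀ x ∈ Set.Icc 0 L, f x = g x) ∧ (∀ x, g x ≠ 0) ∧
      ∃ M m, (∀ x, |g x| ≤ M) ∧ (∀ x, |(g x ^ 2)⁻¹| ≤ m) := by
    obtain ⟨M, hM⟩ := isCompact_Icc.exists_bound_of_continuousOn hfc
    obtain ⟨m, hm⟩ := isCompact_Icc.exists_bound_of_continuousOn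
      ((hfc.pow 2).inv₀ (fun x hx => pow_ne_zero 2 (hfne x hx)))
    refine ⟨fun x => f (Set.projIcc 0 L hL.le x), ?_, ?_, ?_, M, m, ?_, ?_⟩
    · exact (continuousOn_iff_continuous_domRestrict.1 hfc).comp continuous_projIcc
    · intro x hx
      simp only [Set.projIcc_of_mem hL.le hx]
    · intro x; exact hfne _ (Set.projIcc 0 L hL.le x).2
    · intro x; exact hM _ (Set.projIcc 0 L hL.le x).2
    · intro x; exact hm _ (Set.projIcc 0 L hL.le x).2
  have hgd : ∀ x ∈ Set.Ioo 0 L, HasDerivAt g (f' x) x := by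
    intro x hx
    have h := (hf x (Set.Ioo_subset_Icc_self hx)).hasDerivAt (Icc_mem_nhds hx.1 hx.2)
    apply h.congr_of_eventuallyEq
    filter_upwards [Icc_mem_nhds hx.1 hx.2] with y hy
    exact (hgf y hy).symm
  have hgd' : ∀ x ∈ Set.Ioo 0 L, HasDerivAt f' (q x * g x) x := by
    intro x hx
    rw [← hgf x (Set.Ioo_subset_Icc_self hx)]
    exact (hf' x (Set.Ioo_subset_Icc_self hx)).hasDerivAt (Icc_mem_nhds hx.1 hx.2)
  -- extension of `u`
  obtain ⟨v, hvc, hvu⟩ : ∃ v : ℝ × ℝ → ℝ, Continuous v ∧ ∀ p ∈ D, v p = u p := by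
    obtain ⟨v, hv⟩ := ContinuousMap.exists_restrict_eq (Y := ℝ) (isClosed_closure (s := D))
      ⟨(closure D).domRestrict u, continuousOn_iff_continuous_domRestrict.1 hu_cont⟩
    refine ⟨v, v.continuous, fun p hp => ?_⟩
    have := congrArg (fun F => F ⟨p, subset_closure hp⟩) hv
    exact this
  have hvx : ∀ p ∈ D, HasDerivAt (fun x => v (x, p.2)) (ux p) p.1 := by
    intro p hp
    apply (hux p hp).congr_of_eventuallyEq
    have hc : ContinuousAt (fun x : ℝ => (x, p.2)) p.1 := by fun_prop
    filter_upwards [hc.preimage_mem_nhds (hDo.mem_nhds hp)] with y hy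
    exact hvu _ hy
  have hvt : ∀ p ∈ D, HasDerivAt (fun t => v (p.1, t)) (ut p) p.2 := by
    intro p hp
    apply (hut p hp).congr_of_eventuallyEq
    have hc : ContinuousAt (fun t : ℝ => (p.1, t)) p.2 := by fun_prop
    filter_upwards [hc.preimage_mem_nhds (hDo.mem_nhds hp)] with y hy
    exact hvu _ hy
  have hveq : ∀ p ∈ D, uxx p - q p.1 * v p = ut p := by
    intro p hp; rw [hvu p hp]; exact heq p hp
  -- geometric parameters
  obtain ⟨p0, hp0, hmin⟩ := hDc.exists_isMinOn hnonempty continuousOn_fst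
  obtain ⟨δ0, hδ0, hthick⟩ := hDc.exists_cthickening_subset_open hDo hDcD
  have huc := ((isCompact_Icc (a := (0:ℝ)) (b := L)).prod
    (isCompact_Icc (a := (0:ℝ)) (b := T))).uniformContinuousOn_of_continuous hvc.continuousOn
  obtain ⟨δ1, hδ1, hosc⟩ := Metric.uniformContinuousOn_iff.1 huc (ε / 4) (by positivity)
  obtain ⟨δ, hδ, hδle0, hδlt1⟩ : ∃ δ, 0 < δ ∧ δ ≤ δ0 ∧ δ < δ1 :=
    ⟨min δ0 (δ1 / 2), by positivity, min_le_left _ _, (min_le_right _ _).trans_lt (by linarith)⟩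
  have hseg : ∀ x t, (x, t) ∈ Dc → ∀ τ ∈ Set.Icc (t - δ) t, (x, τ) ∈ D ∧ dist (x, t) (x, τ) ≤ δ := by
    intro x t hp τ hτ
    have hd : dist (x, t) (x, τ) ≤ δ := by
      rw [Prod.dist_eq, dist_self, Real.dist_eq, abs_of_nonneg (by linarith [hτ.2])]
      exact max_le hδ.le (by linarith [hτ.1])
    refine ⟨hthick (Metric.mem_cthickening_of_dist_le _ _ _ _ hp ?_), hd⟩
    rw [dist_comm]; exact hd.trans hδle0
  obtain ⟨N, a, ha⟩ := core_approx hgc hgne (by rw [← hgf 0 ⟨le_rfl, hL.le⟩, hf0]) hL hT hM hm hgd hgd' hvc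
    (D := D) (Dc := Dc) hvx huxx hvt hux_cont huxx_cont hut_cont hveq
    (x1 := p0.1) (δ := δ) (ε := ε) (hDL p0.1 p0.2 (hDcD hp0)).1 hδ hε (by
      intro x t hp
      obtain ⟨h1, h2, h3, h4⟩ := hDL x t (hDcD hp)
      have h5 := hseg x t hp (t - δ) ⟨le_rfl, by linarith⟩
      have h6 := hDL _ _ h5.1
      refine ⟨hmin hp, h2, by linarith [h6.2.2.1], h4.le, ?_, ?_⟩
      · intro y hy τ hτ
        exact hDmono x τ y (hseg x t hp τ hτ).1 hy.1 hy.2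
      · intro τ hτ
        obtain ⟨h7, h8⟩ := hseg x t hp τ hτ
        obtain ⟨_, _, h9, h10⟩ := hDL x τ h7
        exact (hosc (x, t) ⟨⟨h1.le, h2⟩, ⟨h3.le, h4.le⟩⟩ (x, τ) ⟨⟨h1.le, h2⟩, ⟨h9.le, h10.le⟩⟩
          (h8.trans_lt hδlt1)).le)
  refine ⟨N, a, fun p hp => ?_⟩
  have h := ha p hp
  obtain ⟨h1, h2, _⟩ := hDL p.1 p.2 (hDcD hp)
  rw [hvu p (hDcD hp)] at h
  simp only [heatPoly_congr hgf _ p.2 p.1 ⟨h1.le, h2⟩]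
  exact h
end
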